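/- arXiv:2204.08008 — 4 statements merged into one kernel-verified Lean document; each statement's English description precedes it below -/
import Mathlib

section
/- Let k be a field of characteristic 0 that is finitely generated as a field extension of ℚ, with a fixed algebraic closure k̄. Let Γ₁ and Γ₂ be finitely generated subgroups of the multiplicative group k^×. If for every prime number ℓ and every natural number n the subfields k(Γ₁^{1/ℓⁿ}) and k(Γ₂^{1/ℓⁿ}) of k̄ coincide, then Γ₁ = Γ₂. -/
/-- The isolator (root closure) of `H` has finite exponent modulo `H`. -/
def Subgroup.HasBoundedIsolator {G : Type*} [CommGroup G] (H : Subgroup G) : Prop :=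
  ∃ e : ℕ, 0 < e ∧ ∀ w : G, (∃ m : ℕ, 0 < m ∧ w ^ m ∈ H) → w ^ e ∈ H

/-- Reduction to a subset `B` that is detected by homomorphisms to `ℤ`. -/
theorem Subgroup.hasBoundedIsolator_closure_of_forall_hom {G : Type*} [CommGroup G] (B : Set G)
    (hB : ∀ S : Finset G, (S : Set G) ⊆ B → (closure (S : Set G)).HasBoundedIsolator)
    (hv : ∀ x ∉ B, ∃ v : G →* Multiplicative ℤ, v x ≠ 1) (S : Finset G) :
    (closure (S : Set G)).HasBoundedIsolator := by
  classical
  induction hn : S.card using Nat.strong_induction_on generalizing S with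
  | _ n ih =>
  by_cases hS : (S : Set G) ⊆ B
  · exact hB S hS
  obtain ⟨x, hxS, hxB⟩ := Set.not_subset.1 hS
  obtain ⟨v, hvx⟩ := hv x hxB
  set c : ℤ := (v x).toAdd with hc
  have hc0 : c ≠ 0 := fun h => hvx (by simpa [hc] using h)
  let φ : G →* G :=
    { toFun := fun g => g ^ c * (x ^ (v g).toAdd)⁻¹
      map_one' := by simp
      map_mul' := fun g h => by
        simp only [map_mul, toAdd_mul, mul_zpow, zpow_add, mul_inv]
        exact mul_mul_mul_comm _ _ _ _ }
  have hφ : ∀ g, φ g = g ^ c * (x ^ (v g).toAdd)⁻¹ := fun _ => rfl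
  have hφx : φ x = 1 := by simp [hφ, hc]
  have hxc : x ∈ closure (S : Set G) := subset_closure hxS
  have hcard : ((S.erase x).image φ).card < n :=
    (Finset.card_image_le).trans_lt (hn ▸ Finset.card_erase_lt_of_mem hxS)
  obtain ⟨e, he, H⟩ := ih _ hcard _ rfl
  have hmap : (closure (S : Set G)).map φ ≤ closure (((S.erase x).image φ : Finset G) : Set G) := by
    rw [MonoidHom.map_closure, closure_le]
    rintro _ ⟨g, hg, rfl⟩
    by_cases hgx : g = x
    · rw [hgx, hφx]; exact one_mem _
    · exact subset_closure (by
        simp only [Finset.coe_image]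
        exact ⟨g, by simpa [hgx] using hg, rfl⟩)
  have hle : closure (((S.erase x).image φ : Finset G) : Set G) ≤ closure (S : Set G) := by
    rw [closure_le]
    intro y hy
    simp only [Finset.coe_image] at hy
    obtain ⟨g, hg, rfl⟩ := hy
    have hg' : g ∈ closure (S : Set G) := subset_closure (Finset.mem_of_mem_erase hg)
    exact mul_mem (zpow_mem hg' _) (inv_mem (zpow_mem hxc _))
  refine ⟨c.natAbs * e, Nat.mul_pos (Int.natAbs_pos.2 hc0) he, fun w ⟨m, hm, hw⟩ => ?_⟩
  have h1 : φ w ^ e ∈ closure (S : Set G) :=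
    hle (H _ ⟨m, hm, by rw [← map_pow]; exact hmap (mem_map_of_mem _ hw)⟩)
  have h2 : (w ^ c) ^ e ∈ closure (S : Set G) := by
    have : w ^ c = φ w * x ^ (v w).toAdd := by simp [hφ]
    rw [this, mul_pow]
    exact mul_mem h1 (pow_mem (zpow_mem hxc _) _)
  rw [pow_mul]
  rcases Int.natAbs_eq c with h | h
  · rwa [h, zpow_natCast] at h2
  · rw [h, zpow_neg, zpow_natCast, inv_pow] at h2
    exact inv_mem_iff.1 h2

/-- Boundedness from finiteness of a fundamental domain for the root closure. -/
theorem Subgroup.hasBoundedIsolator_closure_of_finite {G : Type*} [CommGroup G] (S : Finset G)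
    (hfin : {w : G | ∃ N : ℕ, 0 < N ∧ ∃ r : S → ℕ, (∀ i, r i ≤ N) ∧
      w ^ N = ∏ i : S, (i : G) ^ r i}.Finite) :
    (closure (S : Set G)).HasBoundedIsolator := by
  classical
  set T := {w : G | ∃ N : ℕ, 0 < N ∧ ∃ r : S → ℕ, (∀ i, r i ≤ N) ∧
      w ^ N = ∏ i : S, (i : G) ^ r i} with hT
  have hSc : ∀ i : S, (i : G) ∈ closure (S : Set G) := fun i => subset_closure i.2
  have hTm : ∀ t : G, ∃ m : ℕ, 0 < m ∧ (t ∈ T → t ^ m ∈ closure (S : Set G)) := by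
    intro t
    by_cases ht : t ∈ T
    · obtain ⟨N, hN, r, -, h⟩ := ht
      exact ⟨N, hN, fun _ => h ▸ prod_mem fun i _ => pow_mem (hSc i) _⟩
    · exact ⟨1, one_pos, fun h => absurd h ht⟩
  choose m hm hmT using hTm
  refine ⟨∏ t ∈ hfin.toFinset, m t, Finset.prod_pos fun t _ => hm t, ?_⟩
  rintro w ⟨N, hN, hw⟩
  obtain ⟨a, ha⟩ : ∃ a : S → ℤ, w ^ N = ∏ i : S, (i : G) ^ a i := by
    refine closure_induction (p := fun g _ => ∃ a : S → ℤ, g = ∏ i : S, (i : G) ^ a i)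
      ?_ ⟨0, by simp⟩ ?_ ?_ hw
    · intro x hx
      refine ⟨Pi.single ⟨x, hx⟩ 1, ?_⟩
      rw [Finset.prod_eq_single (⟨x, hx⟩ : S)]
      · simp
      · intro b _ hb; simp [Pi.single_eq_of_ne hb]
      · simp
    · rintro x y - - ⟨a, rfl⟩ ⟨b, rfl⟩
      exact ⟨a + b, by simp [zpow_add, Finset.prod_mul_distrib]⟩
    · rintro x - ⟨a, rfl⟩
      exact ⟨-a, by simp⟩
  have hN' : (0 : ℤ) < N := by exact_mod_cast hN
  set γ : G := ∏ i : S, (i : G) ^ (a i / N) with hγ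
  have hγm : γ ∈ closure (S : Set G) := prod_mem fun i _ => zpow_mem (hSc i) _
  have hwT : w * γ⁻¹ ∈ T := by
    refine ⟨N, hN, fun i => (a i % N).toNat, fun i => ?_, ?_⟩
    · have := Int.emod_lt_of_pos (a i) hN'
      simp only [Int.toNat_le]
      exact this.le
    · rw [mul_pow, ha, hγ, inv_pow, ← Finset.prod_pow, ← Finset.prod_inv_distrib,
        ← Finset.prod_mul_distrib]
      refine Finset.prod_congr rfl fun i _ => ?_
      rw [← zpow_natCast (i : G), Int.toNat_of_nonneg (Int.emod_nonneg _ hN'.ne'),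
        ← zpow_natCast (_ ^ _) N, ← zpow_mul, ← zpow_neg, ← zpow_add]
      congr 1
      have := Int.emod_add_mul_ediv (a i) N
      linarith [mul_comm (a i / (N : ℤ)) N]
  have h1 : (w * γ⁻¹) ^ (∏ t ∈ hfin.toFinset, m t) ∈ closure (S : Set G) := by
    obtain ⟨q, hq⟩ := Finset.dvd_prod_of_mem m (hfin.mem_toFinset.2 hwT)
    rw [hq, pow_mul]
    exact pow_mem (hmT _ hwT) _
  rw [mul_pow] at h1
  exact (Subgroup.mul_mem_cancel_right _ (pow_mem (inv_mem hγm) _)).1 h1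

theorem NumberField.finite_setOf_pow_eq_prod (F : Type*) [Field F] [NumberField F]
    {ι : Type*} [Fintype ι] (g : ι → F) :
    {w : F | ∃ N : ℕ, 0 < N ∧ ∃ r : ι → ℕ, (∀ i, r i ≤ N) ∧ w ^ N = ∏ i, g i ^ r i}.Finite := by
  classical
  have hd : ∀ i, ∃ d : ℤ, d ≠ 0 ∧ IsIntegral ℤ ((d : F) * g i) := by
    intro i
    have : IsAlgebraic ℤ (g i) :=
      (IsFractionRing.isAlgebraic_iff ℤ ℚ F).2 (.of_finite ℚ (g i))
    obtain ⟨d, hd, h⟩ := this.exists_integral_multiple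
    exact ⟨d, hd, by simpa [Algebra.smul_def] using h⟩
  choose d hd0 hdi using hd
  set D : F := ∏ i, (d i : F) with hD
  have hD0 : D ≠ 0 := Finset.prod_ne_zero_iff.2 fun i _ => by exact_mod_cast hd0 i
  set B : ℝ := ∑ φ : F →+* ℂ, ‖φ D‖ * ∏ i, max 1 ‖φ (g i)‖ with hB
  refine ((NumberField.Embeddings.finite_of_norm_le F ℂ B).image (fun x => D⁻¹ * x)).subset ?_
  rintro w ⟨N, hN, r, hr, hw⟩
  refine ⟨D * w, ⟨?_, fun φ => ?_⟩, by simp [hD0]⟩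
  · refine IsIntegral.of_pow hN ?_
    have : (D * w) ^ N = ∏ i, ((d i : F) ^ (N - r i) * ((d i : F) * g i) ^ r i) := by
      rw [mul_pow, hw, hD, ← Finset.prod_pow, ← Finset.prod_mul_distrib]
      refine Finset.prod_congr rfl fun i _ => ?_
      rw [mul_pow, ← mul_assoc, ← pow_add, Nat.sub_add_cancel (hr i)]
    rw [this]
    exact IsIntegral.prod _ fun i _ => ((isIntegral_algebraMap (R := ℤ) (x := d i)).pow _).mul
      ((hdi i).pow _)
  · have h1 : ‖φ w‖ ≤ ∏ i, max 1 ‖φ (g i)‖ := by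
      refine le_of_pow_le_pow_left₀ hN.ne' (Finset.prod_nonneg fun i _ => by positivity) ?_
      rw [← norm_pow, ← map_pow, hw, map_prod, norm_prod, ← Finset.prod_pow]
      refine Finset.prod_le_prod (fun _ _ => norm_nonneg _) fun i _ => ?_
      rw [map_pow, norm_pow]
      calc ‖φ (g i)‖ ^ r i ≤ max 1 ‖φ (g i)‖ ^ r i := by gcongr; exact le_max_right _ _
        _ ≤ _ := pow_le_pow_right₀ (le_max_left _ _) (hr i)
    rw [map_mul, norm_mul]
    refine (mul_le_mul_of_nonneg_left h1 (norm_nonneg _)).trans ?_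
    exact Finset.single_le_sum (f := fun φ : F →+* ℂ => ‖φ D‖ * ∏ i, max 1 ‖φ (g i)‖)
      (fun φ _ => by positivity) (Finset.mem_univ φ)

/-- Total degree as a homomorphism to `ℤᵐ⁰`. -/
noncomputable def MvPolynomial.totalDegreeHom (ι R : Type*) [CommRing R] [IsDomain R] :
    MvPolynomial ι R →* WithZero (Multiplicative ℤ) where
  toFun f := open Classical in if f = 0 then 0 else WithZero.exp (f.totalDegree : ℤ)
  map_one' := by simp
  map_mul' f g := by
    by_cases hf : f = 0
    · simp [hf]
    by_cases hg : g = 0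
    · simp [hg]
    simp [hf, hg, MvPolynomial.totalDegree_mul_of_isDomain hf hg, WithZero.exp_add]

theorem exists_hom_ne_one_of_transcendental (F : Type*) {L : Type*} [Field F] [Field L]
    [Algebra F L] [Algebra.EssFiniteType F L] (x : Lˣ) (hx : Transcendental F (x : L)) :
    ∃ v : Lˣ →* Multiplicative ℤ, v x ≠ 1 := by
  obtain ⟨s, hxs, hs⟩ := exists_isTranscendenceBasis_superset (R := F) (s := {(x : L)})
    ((algebraicIndependent_singleton_iff (⟨(x : L), rfl⟩ : ({(x : L)} : Set L))).2 hx)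
  have hxs' : (x : L) ∈ s := hxs rfl
  set E := IntermediateField.adjoin F (Set.range ((↑) : s → L)) with hE
  have halg : Algebra.IsAlgebraic E L := hs.isAlgebraic_field
  have : Algebra.EssFiniteType E L := .of_comp F _ _
  have : Module.Finite E L := Algebra.finite_of_essFiniteType_of_isAlgebraic
  let A := MvPolynomial s F
  have hu : ∀ y : nonZeroDivisors A, IsUnit (MvPolynomial.totalDegreeHom s F y) := by
    intro y
    have : (y : A) ≠ 0 := nonZeroDivisors.ne_zero y.2
    simp [MvPolynomial.totalDegreeHom, this]
  let d : FractionRing A →* WithZero (Multiplicative ℤ) :=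
    (IsLocalization.toLocalizationMap (nonZeroDivisors A) (FractionRing A)).lift hu
  let v : Lˣ →* Multiplicative ℤ := (WithZero.unitsWithZeroEquiv.toMonoidHom.comp
    (Units.map (d.comp ((hs.1.aevalEquivField.symm : E ≃ₐ[F] FractionRing A) :
      E →* FractionRing A)))).comp
      (Units.map (Algebra.norm E))
  have hX : (hs.1.aevalEquivField.symm : E ≃ₐ[F] FractionRing A)
      ⟨(x : L), IntermediateField.subset_adjoin F _ ⟨⟨x, hxs'⟩, rfl⟩⟩ =
      algebraMap A (FractionRing A) (MvPolynomial.X ⟨x, hxs'⟩) := by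
    rw [AlgEquiv.symm_apply_eq]
    apply Subtype.ext
    rw [AlgebraicIndependent.aevalEquivField_algebraMap_apply_coe]
    simp
  have hdX : d (algebraMap A (FractionRing A) (MvPolynomial.X ⟨x, hxs'⟩)) = WithZero.exp 1 := by
    refine ((IsLocalization.toLocalizationMap (nonZeroDivisors A) (FractionRing A)).lift_eq hu
      _).trans ?_
    simp [MvPolynomial.totalDegreeHom]
  have hnorm : Algebra.norm E (x : L) =
      (⟨(x : L), IntermediateField.subset_adjoin F _ ⟨⟨x, hxs'⟩, rfl⟩⟩ : E) ^ Module.finrank E L :=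
    Algebra.norm_algebraMap (S := L)
      (⟨(x : L), IntermediateField.subset_adjoin F _ ⟨⟨x, hxs'⟩, rfl⟩⟩ : E)
  refine ⟨v, fun h => ?_⟩
  have h1 : d ((hs.1.aevalEquivField.symm : E ≃ₐ[F] FractionRing A) (Algebra.norm E (x : L))) = 1 :=
    congrArg Units.val (WithZero.unitsWithZeroEquiv.injective (h.trans (map_one _).symm))
  rw [hnorm, map_pow, map_pow, hX, hdX, ← WithZero.exp_nsmul, ← WithZero.exp_zero,
    WithZero.exp_inj] at h1
  have := Module.finrank_pos (R := E) (M := L)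
  simp at h1
  omega

open scoped IntermediateField.algebraAdjoinAdjoin in
theorem finiteDimensional_algebraicClosure (F L : Type*) [Field F] [Field L] [Algebra F L]
    [Algebra.EssFiniteType F L] : FiniteDimensional F (algebraicClosure F L) := by
  obtain ⟨s, hs⟩ := exists_isTranscendenceBasis F L
  set E := IntermediateField.adjoin F (Set.range ((↑) : s → L)) with hE
  have halg : Algebra.IsAlgebraic E L := hs.isAlgebraic_field
  have : Algebra.EssFiniteType E L := .of_comp F _ _
  have : Module.Finite E L := Algebra.finite_of_essFiniteType_of_isAlgebraic
  have hs' := hs.1.algebraicClosure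
  let K := algebraicClosure F L
  let b := Module.Basis.ofVectorSpace F K
  have hb : LinearIndependent E (fun i => (b i : L)) := by
    rw [← LinearIndependent.iff_fractionRing (R := Algebra.adjoin F (Set.range ((↑) : s → L)))
      (K := E)]
    rw [linearIndependent_iff']
    intro t g hg i hi
    have hp : ∀ j, ∃ p : MvPolynomial s F, MvPolynomial.aeval ((↑) : s → L) p = (g j : L) := by
      intro j
      exact (Algebra.adjoin_range_eq_range_aeval F ((↑) : s → L)).le (g j).2
    choose p hp using hp
    have h0 : ∑ j ∈ t, MvPolynomial.C (b j) * MvPolynomial.map (algebraMap F K) (p j) = 0 := by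
      apply hs'
      simp only [map_sum, map_mul, map_zero, MvPolynomial.algHom_C]
      rw [← hg]
      refine Finset.sum_congr rfl fun j _ => ?_
      rw [MvPolynomial.aeval_map_algebraMap K, hp, mul_comm]
      rfl
    have h1 : p i = 0 := by
      ext m
      have h2 : ∑ j ∈ t, MvPolynomial.coeff m (p j) • b j = 0 := by
        have h3 := congrArg (MvPolynomial.coeff m) h0
        simp only [MvPolynomial.coeff_sum, MvPolynomial.coeff_C_mul, MvPolynomial.coeff_map,
          MvPolynomial.coeff_zero] at h3
        simpa only [Algebra.smul_def, mul_comm] using h3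
      exact linearIndependent_iff'.1 b.linearIndependent t _ h2 i hi
    exact Subtype.ext (by rw [← hp i, h1]; simp)
  have : Finite (Module.Basis.ofVectorSpaceIndex F K) := hb.finite
  exact Module.Finite.of_basis b

theorem Subgroup.FG.hasBoundedIsolator_units {L : Type*} [Field L] [CharZero L]
    [Algebra.EssFiniteType ℚ L] {Γ : Subgroup Lˣ} (hΓ : Γ.FG) : Γ.HasBoundedIsolator := by
  classical
  obtain ⟨S, rfl⟩ := hΓ
  refine Subgroup.hasBoundedIsolator_closure_of_forall_hom {x : Lˣ | IsAlgebraic ℚ (x : L)}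
    (fun S hS => ?_) (fun x hx => exists_hom_ne_one_of_transcendental ℚ x hx) S
  let K := algebraicClosure ℚ L
  have : FiniteDimensional ℚ K := finiteDimensional_algebraicClosure ℚ L
  have : NumberField K := { }
  refine Subgroup.hasBoundedIsolator_closure_of_finite S ?_
  let g : S → K := fun i => ⟨(i : Lˣ), mem_algebraicClosure_iff.2 (hS i.2)⟩
  refine Set.Finite.of_finite_image (f := ((↑) : Lˣ → L))
    (((NumberField.finite_setOf_pow_eq_prod K g).image ((↑) : K → L)).subset ?_)
    Units.val_injective.injOn
  rintro _ ⟨w, ⟨N, hN, r, hr, hw⟩, rfl⟩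
  have hwL : (w : L) ^ N = ∏ i : S, ((i : Lˣ) : L) ^ r i := by
    simpa using congrArg (Units.val) hw
  have hwK : (w : L) ∈ K := by
    refine mem_algebraicClosure_iff.2 (IsAlgebraic.of_pow hN ?_)
    rw [hwL]
    exact mem_algebraicClosure_iff.1 (prod_mem fun i _ => pow_mem (g i).2 _)
  exact ⟨⟨w, hwK⟩, ⟨N, hN, r, hr, Subtype.ext (by simpa [g] using hwL)⟩, rfl⟩

/-- Independence of eigenvectors with distinct Kummer characters. -/
theorem exists_mem_forall_map_div_eq {k Ω : Type*} [Field k] [Field Ω] [Algebra k Ω]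
    {N : ℕ} {y : Ω} (hy : y ≠ 0) (H : Set (Ω ≃ₐ[k] Ω))
    (hH : ∀ σ ∈ H, ∀ ζ : Ω, ζ ^ N = 1 → σ ζ = ζ) (hyH : ∀ σ ∈ H, (σ y / y) ^ N = 1)
    (T : Finset Ω) (hT0 : ∀ s ∈ T, s ≠ 0) (hT : ∀ s ∈ T, ∀ σ ∈ H, (σ s / s) ^ N = 1)
    (c : Ω → Ω) (hc : ∀ σ ∈ H, ∀ s, σ (c s) = c s) (hsum : ∑ s ∈ T, c s * s = y) :
    ∃ s ∈ T, ∀ σ ∈ H, σ (y / s) = y / s := by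
  classical
  induction T using Finset.induction_on generalizing c with
  | empty => exact absurd hsum.symm (by simpa using hy)
  | insert t T ht ih =>
    by_cases h : ∀ σ ∈ H, σ (y / t) = y / t
    · exact ⟨t, Finset.mem_insert_self _ _, h⟩
    push Not at h
    obtain ⟨τ, hτ, hne⟩ := h
    have ht0 : t ≠ 0 := hT0 t (Finset.mem_insert_self _ _)
    have hd : τ y / y - τ t / t ≠ 0 := by
      intro h0
      apply hne
      have hτt : τ t ≠ 0 := by simpa using ht0
      rw [map_div₀, div_eq_div_iff hτt ht0]
      rw [sub_eq_zero, div_eq_div_iff hy ht0] at h0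
      linear_combination h0
    have hfix : ∀ σ ∈ H, ∀ s ∈ insert t T, σ (τ s / s) = τ s / s :=
      fun σ hσ s hs => hH σ hσ _ (hT s hs τ hτ)
    have e1 : ∑ s ∈ insert t T, c s * (τ s / s - τ t / t) * s = (τ y / y - τ t / t) * y := by
      have e2 : τ y = ∑ s ∈ insert t T, c s * τ s := by
        rw [← hsum, map_sum]
        exact Finset.sum_congr rfl fun s _ => by rw [map_mul, hc τ hτ]
      rw [sub_mul, div_mul_cancel₀ _ hy, e2]
      have e3 : τ t / t * y = ∑ s ∈ insert t T, τ t / t * (c s * s) := by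
        rw [← Finset.mul_sum, hsum]
      rw [e3, ← Finset.sum_sub_distrib]
      refine Finset.sum_congr rfl fun s hs => ?_
      have := hT0 s hs
      field_simp
    rw [Finset.sum_insert ht, sub_self, mul_zero, zero_mul, zero_add] at e1
    obtain ⟨s, hs, h⟩ := ih (fun s hs => hT0 s (Finset.mem_insert_of_mem hs))
      (fun s hs => hT s (Finset.mem_insert_of_mem hs))
      (fun s => if s ∈ insert t T then c s * (τ s / s - τ t / t) / (τ y / y - τ t / t) else 0)
      (fun σ hσ s => by
        by_cases hs : s ∈ insert t T
        · simp only [if_pos hs]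
          rw [map_div₀, map_mul, map_sub, map_sub, hc σ hσ, hfix σ hσ s hs,
            hfix σ hσ t (Finset.mem_insert_self _ _), hH σ hσ _ (hyH τ hτ)]
        · simp only [if_neg hs, map_zero]) (by
        rw [eq_comm, ← mul_right_inj' hd, ← e1, Finset.mul_sum]
        refine Finset.sum_congr rfl fun s hs => ?_
        rw [if_pos (Finset.mem_insert_of_mem hs), ← mul_assoc, mul_div_cancel₀ _ hd])
    exact ⟨s, Finset.mem_insert_of_mem hs, h⟩

/-- Kummer theory: an `N`-th root of an element of `k` lying in `k(Γ^{1/N})` differs from an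
`N`-th root of an element of `Γ` by an element of `k(μ_N)`. -/
theorem exists_root_forall_map_div_eq {k Ω : Type*} [Field k] [Field Ω] [Algebra k Ω]
    [Algebra.IsAlgebraic k Ω] (Γ : Subgroup kˣ) {N : ℕ} (hN : 0 < N) {x : k} (hx : x ≠ 0) {y : Ω}
    (hyx : y ^ N = algebraMap k Ω x)
    (hy : y ∈ IntermediateField.adjoin k
      {s : Ω | ∃ γ ∈ Γ, s ^ N = algebraMap k Ω (γ : k)}) :
    ∃ s : Ω, (∃ γ ∈ Γ, s ^ N = algebraMap k Ω (γ : k)) ∧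
      ∀ σ : Ω ≃ₐ[k] Ω, (∀ ζ : Ω, ζ ^ N = 1 → σ ζ = ζ) → σ (y / s) = y / s := by
  classical
  have hroot : ∀ {z : k} (_ : z ≠ 0) {s : Ω} (_ : s ^ N = algebraMap k Ω z),
      s ≠ 0 ∧ ∀ σ : Ω ≃ₐ[k] Ω, (σ s / s) ^ N = 1 := by
    intro z hz s hs
    have hz' : algebraMap k Ω z ≠ 0 := by simpa using hz
    refine ⟨fun h => hz' (by rw [← hs, h, zero_pow hN.ne']), fun σ => ?_⟩
    rw [div_pow, ← map_pow, hs, AlgEquiv.commutes, div_self hz']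
  let M : Submonoid Ω :=
    { carrier := {s : Ω | ∃ γ ∈ Γ, s ^ N = algebraMap k Ω (γ : k)}
      one_mem' := ⟨1, one_mem _, by simp⟩
      mul_mem' := by
        rintro a b ⟨γ, hγ, ha⟩ ⟨δ, hδ, hb⟩
        exact ⟨γ * δ, mul_mem hγ hδ, by rw [mul_pow, ha, hb]; simp⟩ }
  have hspan : y ∈ Submodule.span k (M : Set Ω) := by
    have h1 : y ∈ Algebra.adjoin k (M : Set Ω) := by
      rw [← IntermediateField.adjoin_toSubalgebra]
      exact hy
    have h2 := Algebra.adjoin_eq_span k (M : Set Ω)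
    rw [Submonoid.closure_eq] at h2
    rw [← h2]
    exact h1
  obtain ⟨c, T, hTM, hc, hsum⟩ := Submodule.mem_span_iff_exists_finset_subset.1 hspan
  obtain ⟨s, hs, h⟩ := exists_mem_forall_map_div_eq (N := N) (hroot hx hyx).1
    {σ : Ω ≃ₐ[k] Ω | ∀ ζ : Ω, ζ ^ N = 1 → σ ζ = ζ} (fun σ hσ => hσ)
    (fun σ _ => (hroot hx hyx).2 σ) T
    (fun s hs => let ⟨γ, _, h⟩ := hTM hs; (hroot γ.ne_zero h).1)
    (fun s hs σ _ => let ⟨γ, _, h⟩ := hTM hs; (hroot γ.ne_zero h).2 σ)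
    (fun s => algebraMap k Ω (c s)) (fun σ _ s => σ.commutes _)
    (by simpa [Algebra.smul_def] using hsum)
  exact ⟨s, hTM hs, h⟩

theorem exists_geom_sum_range_prime_pow_eq (p e m : ℕ) :
    ∃ t, ∑ i ∈ Finset.range (p ^ m), (1 + p ^ 2 * e) ^ i = p ^ m * (1 + p * t) := by
  have hmul : ∀ c a b : ℕ, ∑ i ∈ Finset.range (a * b), c ^ i =
      (∑ i ∈ Finset.range a, c ^ i) * ∑ j ∈ Finset.range b, (c ^ a) ^ j := by
    intro c a b
    induction b with
    | zero => simp
    | succ b ih =>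
      rw [mul_add_one, Finset.sum_range_add, ih, Finset.sum_range_succ, mul_add, ← pow_mul,
        Finset.sum_mul _ _ (c ^ (a * b))]
      simp only [pow_add, mul_comm]
  have hpow : ∀ f j : ℕ, ∃ g, (1 + p ^ 2 * f) ^ j = 1 + p ^ 2 * g := by
    intro f j
    induction j with
    | zero => exact ⟨0, by simp⟩
    | succ j ih =>
      obtain ⟨g, hg⟩ := ih
      exact ⟨g + f + p ^ 2 * g * f, by rw [pow_succ, hg]; ring⟩
  induction m with
  | zero => exact ⟨0, by simp⟩
  | succ m ih =>
    obtain ⟨t, ht⟩ := ih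
    obtain ⟨f, hf⟩ := hpow e (p ^ m)
    choose g hg using hpow f
    rw [pow_succ, hmul, ht, hf]
    simp only [hg, Finset.sum_add_distrib, ← Finset.mul_sum, Finset.sum_const, Finset.card_range,
      smul_eq_mul, mul_one]
    refine ⟨t + ∑ i ∈ Finset.range p, g i + p * t * ∑ i ∈ Finset.range p, g i, by ring⟩

/-- Vanishing, up to an explicit power of `p`, of the first cohomology of the Galois group of
`K(μ_{p^n})` with values in `μ_{p^n}`. -/
theorem exists_pow_eq_of_forall_map_eq {K Ω : Type*} [Field K] [CharZero K] [Field Ω]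
    [Algebra K Ω] [IsAlgClosure K Ω] {p a : ℕ} (hp : p.Prime) (ha : 2 ≤ a)
    (h₁ : ∃ ξ : K, IsPrimitiveRoot ξ (p ^ a)) (h₂ : ¬∃ ξ : K, IsPrimitiveRoot ξ (p ^ (a + 1)))
    {m : ℕ} (hm : 0 < m) {z : K} {y : Ω} (hy : y ≠ 0)
    (hyz : y ^ p ^ (a + m) = algebraMap K Ω z)
    (hfix : ∀ σ : Ω ≃ₐ[K] Ω, (∀ ζ : Ω, ζ ^ p ^ (a + m) = 1 → σ ζ = ζ) → σ y = y) :
    ∃ w : K, w ^ p ^ m = z := by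
  have : IsAlgClosed Ω := IsAlgClosure.isAlgClosed K
  have : CharZero Ω := charZero_of_injective_algebraMap (algebraMap K Ω).injective
  have : IsGalois K Ω := IsAlgClosure.isGalois K Ω
  have hmem : ∀ x : Ω, (∀ σ : Ω ≃ₐ[K] Ω, σ x = x) → ∃ w : K, algebraMap K Ω w = x :=
    fun x hx => (InfiniteGalois.mem_range_algebraMap_iff_fixed x).2 hx
  have hppos : ∀ i, 0 < p ^ i := fun i => pow_pos hp.pos i
  have : ∀ i, NeZero ((p ^ i : ℕ) : Ω) := fun i => ⟨by exact_mod_cast (hppos i).ne'⟩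
  have hcancel : ∀ {ρ : Ω} {u : ℕ}, ρ ^ p ^ (a + m) = 1 → u.Coprime p → ρ ^ u = 1 → ρ = 1 := by
    intro ρ u h1 hu h2
    have := pow_gcd_eq_one.2 ⟨h2, h1⟩
    rwa [(hu.pow_right _ : Nat.gcd u (p ^ (a + m)) = 1), pow_one] at this
  obtain ⟨ζ, hζ⟩ := HasEnoughRootsOfUnity.exists_primitiveRoot Ω (p ^ (a + m))
  have : NeZero (p ^ (a + m)) := ⟨(hppos _).ne'⟩
  have hζpow : ∀ {ρ : Ω}, ρ ^ p ^ (a + m) = 1 → ∃ i : ℕ, ζ ^ i = ρ := fun h =>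
    let ⟨i, _, hi⟩ := hζ.eq_pow_of_pow_eq_one h
    ⟨i, hi⟩
  have hζa : IsPrimitiveRoot (ζ ^ p ^ m) (p ^ a) := hζ.pow (hppos _) (by rw [pow_add, mul_comm])
  have hζa1 : IsPrimitiveRoot (ζ ^ p ^ (m - 1)) (p ^ (a + 1)) :=
    hζ.pow (hppos _) (by rw [← pow_add]; congr 1; omega)
  obtain ⟨σ, hσ⟩ : ∃ σ : Ω ≃ₐ[K] Ω, σ (ζ ^ p ^ (m - 1)) ≠ ζ ^ p ^ (m - 1) := by
    by_contra! h
    obtain ⟨w, hw⟩ := hmem _ h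
    exact h₂ ⟨w, IsPrimitiveRoot.of_map_of_injective (f := algebraMap K Ω) (by rwa [hw])
      (algebraMap K Ω).injective⟩
  obtain ⟨c, hc⟩ := hζpow (ρ := σ ζ) (by rw [← map_pow, hζ.pow_eq_one, map_one])
  have hσpow : ∀ {ρ : Ω}, ρ ^ p ^ (a + m) = 1 → σ ρ = ρ ^ c := by
    intro ρ h
    obtain ⟨i, rfl⟩ := hζpow h
    rw [map_pow, ← hc, ← pow_mul, ← pow_mul, mul_comm]
  have hσa : σ (ζ ^ p ^ m) = ζ ^ p ^ m := by
    obtain ⟨ξ, hξ⟩ := h₁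
    have : NeZero (p ^ a) := ⟨(hppos _).ne'⟩
    obtain ⟨i, _, hi⟩ := (hξ.map_of_injective (algebraMap K Ω).injective).eq_pow_of_pow_eq_one
      hζa.pow_eq_one
    rw [← hi, ← map_pow, AlgEquiv.commutes]
  have hc0 : c ≠ 0 := by
    rintro rfl
    rw [pow_zero, eq_comm, map_eq_one_iff σ σ.injective] at hc
    rw [hc, one_pow] at hσ
    exact hσ (map_one σ)
  obtain ⟨c, rfl⟩ := Nat.exists_eq_succ_of_ne_zero hc0
  have hζ0 : ζ ≠ 0 := hζ.ne_zero (hppos _).ne'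
  have hca : p ^ a ∣ c := by
    rw [map_pow, ← hc, ← pow_mul, mul_comm, pow_mul, pow_succ] at hσa
    exact hζa.dvd_of_pow_eq_one c (mul_right_cancel₀ (pow_ne_zero _ hζ0) (by rw [hσa, one_mul]))
  obtain ⟨u, rfl⟩ := hca
  have hu : u.Coprime p := by
    refine ((Nat.Prime.coprime_iff_not_dvd hp).2 ?_).symm
    rintro ⟨v, rfl⟩
    apply hσ
    rw [map_pow, ← hc, ← pow_mul, mul_comm, pow_mul, Nat.succ_eq_add_one, ← mul_assoc, ← pow_succ,
      pow_succ, pow_mul, hζa1.pow_eq_one, one_pow, one_mul]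
  -- the cocycle `η` of `σ`, and its values on powers of `σ`
  have hyN : ∀ τ : Ω ≃ₐ[K] Ω, (τ y) ^ p ^ (a + m) = y ^ p ^ (a + m) := fun τ => by
    rw [← map_pow, hyz, AlgEquiv.commutes]
  obtain ⟨η, hη⟩ : ∃ η, σ y = η * y := ⟨σ y / y, by field_simp⟩
  have hηN : η ^ p ^ (a + m) = 1 := by
    have := hyN σ
    rw [hη, mul_pow] at this
    exact mul_right_cancel₀ (pow_ne_zero _ hy) (by rw [this, one_mul])
  set c := (p ^ a * u).succ with hcdef
  have hiter : ∀ i : ℕ, (σ ^ i) y = η ^ (∑ j ∈ Finset.range i, c ^ j) * y := by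
    intro i
    induction i with
    | zero => simp
    | succ i ih =>
      rw [pow_succ', AlgEquiv.mul_apply, ih, map_mul, map_pow, hσpow hηN, hη, geom_sum_succ,
        ← pow_mul, pow_succ]
      ring
  have hiterζ : ∀ i : ℕ, (σ ^ i) ζ = ζ ^ c ^ i := by
    intro i
    induction i with
    | zero => simp
    | succ i ih =>
      rw [pow_succ', AlgEquiv.mul_apply, ih, map_pow, ← hc, ← pow_mul, pow_succ']
  obtain ⟨b, rfl⟩ := Nat.exists_eq_add_of_le' ha
  obtain ⟨t, ht⟩ := exists_geom_sum_range_prime_pow_eq p (p ^ b * u) m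
  have hcb : 1 + p ^ 2 * (p ^ b * u) = c := by rw [hcdef, Nat.succ_eq_add_one]; ring
  rw [hcb] at ht
  have hσd : (σ ^ p ^ m) y = y := by
    apply hfix
    intro ρ hρ
    obtain ⟨i, rfl⟩ := hζpow hρ
    rw [map_pow, hiterζ]
    congr 1
    have : c ^ p ^ m = 1 + p ^ (b + 2 + m) * (u * (1 + p * t)) := by
      have h2 : (∑ j ∈ Finset.range (p ^ m), (c : ℤ) ^ j) * ((c : ℤ) - 1) = (c : ℤ) ^ p ^ m - 1 :=
        geom_sum_mul _ _
      have h3 : (∑ j ∈ Finset.range (p ^ m), (c : ℤ) ^ j) = p ^ m * (1 + p * t) := by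
        exact_mod_cast ht
      rw [h3, hcdef] at h2
      zify
      push_cast at h2 ⊢
      rw [hcdef]
      push_cast
      linear_combination (-1) * h2
    rw [this, pow_add, pow_one, pow_mul, hζ.pow_eq_one, one_pow, mul_one]
  have hηm : η ^ p ^ m = 1 := by
    refine hcancel (u := 1 + p * t) (by rw [← pow_mul, mul_comm, pow_mul, hηN, one_pow])
      (by simp) ?_
    rw [← pow_mul, ← ht]
    rw [hiter] at hσd
    exact mul_right_cancel₀ hy (by rw [hσd, one_mul])
  obtain ⟨θ, hθN, hθ⟩ : ∃ θ : Ω, θ ^ p ^ (b + 2 + m) = 1 ∧ θ ^ (p ^ (b + 2) * u) = η := by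
    obtain ⟨i, rfl⟩ := hζpow hηN
    have hi : p ^ (b + 2) ∣ i := by
      rw [← pow_mul] at hηm
      have := hζ.dvd_of_pow_eq_one _ hηm
      rw [pow_add p (b + 2) m] at this
      exact Nat.dvd_of_mul_dvd_mul_right (hppos m) this
    obtain ⟨j, rfl⟩ := hi
    obtain ⟨v, -, hv⟩ := Nat.exists_mul_mod_eq_one_of_coprime (hu.pow_right (b + 2 + m))
      (Nat.one_lt_pow (by omega) hp.one_lt)
    refine ⟨ζ ^ (j * v), by rw [← pow_mul, mul_comm, pow_mul, hζ.pow_eq_one, one_pow], ?_⟩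
    have : j * v * (p ^ (b + 2) * u) = p ^ (b + 2) * j * (u * v) := by ring
    rw [← pow_mul, this, pow_mul, pow_eq_pow_mod _ hηN, hv, pow_one]
  have hθ0 : θ ≠ 0 := by
    rintro rfl
    rw [zero_pow (hppos _).ne'] at hθN
    exact zero_ne_one hθN
  set y' := y / θ with hy'
  have hy'0 : y' ≠ 0 := div_ne_zero hy hθ0
  have hy'N : y' ^ p ^ (b + 2 + m) = algebraMap K Ω z := by rw [hy', div_pow, hθN, div_one, hyz]
  have hσy' : σ y' = y' := by
    have hη0 : η ≠ 0 := by
      rw [← hθ]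
      exact pow_ne_zero _ hθ0
    rw [hy', map_div₀, hη, hσpow hθN, hcdef, pow_succ, hθ]
    field_simp
  obtain ⟨w, hw⟩ := hmem (y' ^ p ^ (b + 2)) (fun τ => by
    obtain ⟨ρ, hρ⟩ : ∃ ρ, τ y' = ρ * y' := ⟨τ y' / y', by field_simp⟩
    have hρN : ρ ^ p ^ (b + 2 + m) = 1 := by
      have : (τ y') ^ p ^ (b + 2 + m) = y' ^ p ^ (b + 2 + m) := by
        rw [← map_pow, hy'N, AlgEquiv.commutes]
      rw [hρ, mul_pow] at this
      exact mul_right_cancel₀ (pow_ne_zero _ hy'0) (by rw [this, one_mul])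
    have hφζ : ∀ ξ : Ω, ξ ^ p ^ (b + 2 + m) = 1 → ((τ * σ)⁻¹ * (σ * τ)) ξ = ξ := by
      intro ξ hξ
      have hτξ : (τ ξ) ^ p ^ (b + 2 + m) = 1 := by rw [← map_pow, hξ, map_one]
      have : (σ * τ) ξ = (τ * σ) ξ := by
        rw [AlgEquiv.mul_apply, AlgEquiv.mul_apply, hσpow hτξ, hσpow hξ, map_pow]
      rw [AlgEquiv.mul_apply, this, ← AlgEquiv.mul_apply, inv_mul_cancel, AlgEquiv.one_apply]
    have hφ : ((τ * σ)⁻¹ * (σ * τ)) y' = y' := by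
      rw [hy', map_div₀, hfix _ hφζ, hφζ θ hθN]
    have hcomm : (σ * τ) y' = (τ * σ) y' := by
      have := congrArg (τ * σ) hφ
      rwa [← AlgEquiv.mul_apply, mul_inv_cancel_left] at this
    rw [AlgEquiv.mul_apply, AlgEquiv.mul_apply, hσy', hρ, map_mul, hσy', hσpow hρN, hcdef,
      pow_succ] at hcomm
    have hρ0 : ρ ≠ 0 := by
      rintro rfl
      rw [zero_pow (hppos _).ne'] at hρN
      exact zero_ne_one hρN
    have hρ1 : ρ ^ (p ^ (b + 2) * u) = 1 :=
      mul_right_cancel₀ hρ0 (mul_right_cancel₀ hy'0 (by rw [hcomm, one_mul]))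
    rw [map_pow, hρ, mul_pow, hcancel (ρ := ρ ^ p ^ (b + 2)) (u := u)
      (by rw [← pow_mul, mul_comm, pow_mul, hρN, one_pow]) hu (by rw [← pow_mul, hρ1]), one_mul])
  refine ⟨w, (algebraMap K Ω).injective ?_⟩
  rw [map_pow, hw, ← pow_mul, ← pow_add, hy'N]

/-- A finitely generated abelian group that is `p`-divisible for every prime `p` is trivial. -/
theorem AddCommGroup.subsingleton_of_forall_prime_divisible {M : Type*} [AddCommGroup M]
    [Module.Finite ℤ M] (h : ∀ p : ℕ, p.Prime → ∀ x : M, ∃ y : M, p • y = x) :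
    Subsingleton M := by
  have hdiv : ∀ n : ℕ, n ≠ 0 → ∀ x : M, ∃ y : M, n • y = x := by
    intro n
    induction n using Nat.recOnMul with
    | zero => exact fun h => absurd rfl h
    | one => exact fun _ x => ⟨x, one_smul _ x⟩
    | prime p hp => exact fun _ => h p hp
    | mul a b iha ihb =>
      intro hab x
      obtain ⟨y, rfl⟩ := iha (left_ne_zero_of_mul hab) x
      obtain ⟨z, rfl⟩ := ihb (right_ne_zero_of_mul hab) y
      exact ⟨z, mul_smul _ _ _⟩
  obtain ⟨r, hr, hr0⟩ := Submodule.exists_sub_one_mem_and_smul_eq_zero_of_fg_of_le_smul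
    (Ideal.span {(2 : ℤ)}) (⊤ : Submodule ℤ M) Module.Finite.fg_top (fun x _ => by
      obtain ⟨y, rfl⟩ := h 2 Nat.prime_two x
      rw [← natCast_zsmul]
      exact Submodule.smul_mem_smul (Ideal.mem_span_singleton_self _) trivial)
  have hrne : r.natAbs ≠ 0 := by
    rintro h0
    rw [Int.natAbs_eq_zero.1 h0, Ideal.mem_span_singleton] at hr
    omega
  refine subsingleton_of_forall_eq 0 fun x => ?_
  obtain ⟨y, rfl⟩ := hdiv _ hrne x
  rcases Int.natAbs_eq r with h | h
  · rw [← natCast_zsmul, ← h, hr0 y trivial]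
  · rw [← natCast_zsmul, ← neg_neg (r.natAbs : ℤ), ← h, neg_smul, hr0 y trivial, neg_zero]

theorem Subgroup.FG.le_of_forall_prime_exists_mul_pow {G : Type*} [CommGroup G]
    {H Γ : Subgroup G} (hΓ : Γ.FG)
    (h : ∀ p : ℕ, p.Prime → ∀ x ∈ Γ, ∃ γ ∈ H, ∃ g ∈ Γ, x = γ * g ^ p) : Γ ≤ H := by
  have : Group.FG Γ := (Group.fg_iff_subgroup_fg Γ).2 hΓ
  let Q := Additive (Γ ⧸ H.subgroupOf Γ)
  have : AddGroup.FG Q := inferInstance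
  have : Module.Finite ℤ Q := Module.Finite.iff_addGroup_fg.2 this
  have : Subsingleton Q := AddCommGroup.subsingleton_of_forall_prime_divisible fun p hp x => by
    induction x using Additive.rec with | ofMul x => ?_
    induction x using QuotientGroup.induction_on with | H x => ?_
    obtain ⟨γ, hγ, g, hg, hx⟩ := h p hp x x.2
    refine ⟨Additive.ofMul (QuotientGroup.mk ⟨g, hg⟩), ?_⟩
    rw [← ofMul_pow, ← QuotientGroup.mk_pow]
    congr 1
    rw [QuotientGroup.eq, Subgroup.mem_subgroupOf]
    simpa [hx, mul_comm] using hγ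
  intro x hx
  have h1 : Additive.ofMul (QuotientGroup.mk (s := H.subgroupOf Γ) (⟨x, hx⟩ : Γ)) = (0 : Q) :=
    Subsingleton.elim _ _
  exact (QuotientGroup.eq_one_iff (N := H.subgroupOf Γ) (⟨x, hx⟩ : Γ)).1 h1

/-- A finitely generated field of characteristic zero contains only finitely many roots of unity
of `p`-power order. -/
theorem exists_maximal_isPrimitiveRoot_prime_pow {L : Type*} [Field L] [CharZero L]
    [Algebra.EssFiniteType ℚ L] {p b : ℕ} (hp : p.Prime) (hb : ∃ ξ : L, IsPrimitiveRoot ξ (p ^ b)) :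
    ∃ a, b ≤ a ∧ (∃ ξ : L, IsPrimitiveRoot ξ (p ^ a)) ∧
      ¬∃ ξ : L, IsPrimitiveRoot ξ (p ^ (a + 1)) := by
  by_contra! H
  have hall : ∀ a, b ≤ a → ∃ ξ : L, IsPrimitiveRoot ξ (p ^ a) := fun a ha =>
    Nat.le_induction hb H a ha
  obtain ⟨e, he, h⟩ := Subgroup.FG.hasBoundedIsolator_units (L := L) Subgroup.FG.bot
  obtain ⟨ξ, hξ⟩ := hall (b + e) (Nat.le_add_right b e)
  have hpos : 0 < p ^ (b + e) := pow_pos hp.pos _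
  obtain ⟨w, rfl⟩ := hξ.isUnit hpos.ne'
  have hw : w ^ e = 1 := h w ⟨_, hpos, Subgroup.mem_bot.2 (Units.ext (by simpa using hξ.pow_eq_one))⟩
  have hdvd := hξ.dvd_of_pow_eq_one e (by simpa using congrArg Units.val hw)
  exact (Nat.le_of_dvd he hdvd).not_gt ((Nat.lt_pow_self hp.one_lt).trans_le
    (Nat.pow_le_pow_right hp.pos (Nat.le_add_left e b)))

/-- If `w ^ p ^ e` and `w ^ e` lie in `Γ`, then `w ^ p ^ e` is a `p`-th power in `Γ`. -/
theorem Subgroup.exists_pow_eq_pow_prime_pow {G : Type*} [CommGroup G] {Γ : Subgroup G} {p e : ℕ}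
    (hp : p.Prime) (he : 0 < e) {w : G} (hw : w ^ e ∈ Γ) (hw' : w ^ p ^ e ∈ Γ) :
    ∃ g ∈ Γ, g ^ p = w ^ p ^ e := by
  obtain ⟨b, -, hb⟩ := (Nat.dvd_prime_pow hp).1 (Nat.gcd_dvd_right e (p ^ e))
  have hlt : b < e := by
    have h1 : p ^ b ≤ e := hb ▸ Nat.gcd_le_left _ he
    exact (Nat.lt_pow_self hp.one_lt).trans_le h1
  have hg : w ^ p ^ b ∈ Γ := by
    rw [← hb, ← zpow_natCast, Nat.gcd_eq_gcd_ab, zpow_add, zpow_mul, zpow_mul, zpow_natCast,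
      zpow_natCast]
    exact mul_mem (zpow_mem hw _) (zpow_mem hw' _)
  refine ⟨(w ^ p ^ b) ^ p ^ (e - b - 1), pow_mem hg _, ?_⟩
  rw [← pow_mul, ← pow_mul, ← pow_succ, ← pow_add]
  congr 2
  omega

theorem exists_eq_mul_pow_of_roots_subset_adjoin {k kbar : Type*} [Field k] [CharZero k]
    [Algebra.EssFiniteType ℚ k] [Field kbar] [Algebra k kbar] [IsAlgClosure k kbar]
    {H Γ : Subgroup kˣ} (hle : H ≤ Γ) (hΓ : Γ.FG) {p : ℕ} (hp : p.Prime)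
    (h : ∀ n : ℕ, {x : kbar | ∃ γ ∈ Γ, x ^ p ^ n = algebraMap k kbar (γ : k)} ⊆
      IntermediateField.adjoin k {x : kbar | ∃ γ ∈ H, x ^ p ^ n = algebraMap k kbar (γ : k)})
    {x : kˣ} (hx : x ∈ Γ) : ∃ γ ∈ H, ∃ g ∈ Γ, x = γ * g ^ p := by
  have : IsAlgClosed kbar := IsAlgClosure.isAlgClosed k
  have : Algebra.IsAlgebraic k kbar := IsAlgClosure.isAlgebraic
  have : CharZero kbar := charZero_of_injective_algebraMap (algebraMap k kbar).injective
  have : NeZero ((p ^ 2 : ℕ) : kbar) := ⟨by exact_mod_cast (pow_pos hp.pos 2).ne'⟩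
  obtain ⟨ζ, hζ⟩ := HasEnoughRootsOfUnity.exists_primitiveRoot kbar (p ^ 2)
  let K := IntermediateField.adjoin k {ζ}
  have : FiniteDimensional k K :=
    IntermediateField.adjoin.finiteDimensional (Algebra.IsIntegral.isIntegral ζ)
  have : CharZero K := charZero_of_injective_algebraMap (algebraMap k K).injective
  have : Algebra.EssFiniteType ℚ K := Algebra.EssFiniteType.comp ℚ k K
  have : IsAlgClosure K kbar := ⟨inferInstance, Algebra.IsAlgebraic.tower_top (K := k) K⟩
  obtain ⟨a, ha, h₁, h₂⟩ := exists_maximal_isPrimitiveRoot_prime_pow (L := K) (b := 2) hp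
    ⟨⟨ζ, IntermediateField.mem_adjoin_simple_self k ζ⟩,
      IsPrimitiveRoot.of_map_of_injective (f := algebraMap K kbar) hζ (algebraMap K kbar).injective⟩
  let f : kˣ →* Kˣ := Units.map (algebraMap k K)
  have hf : Function.Injective f := Units.map_injective (algebraMap k K).injective
  have hΓf : (Γ.map f).FG := by
    classical
    obtain ⟨S, hS⟩ := hΓ
    exact ⟨S.image f, by rw [← hS, MonoidHom.map_closure, Finset.coe_image]⟩
  obtain ⟨e, he, hiso⟩ := hΓf.hasBoundedIsolator_units
  have hpos : 0 < p ^ (a + e) := pow_pos hp.pos _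
  obtain ⟨y, hy⟩ := IsAlgClosed.exists_pow_nat_eq (algebraMap k kbar x) hpos
  obtain ⟨s, ⟨γ, hγ, hs⟩, hfix⟩ := exists_root_forall_map_div_eq H hpos x.ne_zero hy
    (h (a + e) ⟨x, hx, hy⟩)
  have hquot : (y / s) ^ p ^ (a + e) = algebraMap k kbar ((x / γ : kˣ) : k) := by
    rw [div_pow, hy, hs, Units.val_div_eq_div_val, map_div₀]
  have hne : y / s ≠ 0 := by
    intro h0
    rw [h0, zero_pow hpos.ne', eq_comm, map_eq_zero] at hquot
    exact Units.ne_zero _ hquot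
  obtain ⟨w, hw⟩ := exists_pow_eq_of_forall_map_eq (K := K) hp ha h₁ h₂ he
    (z := algebraMap k K ((x / γ : kˣ) : k)) hne
    (by rw [hquot, ← IsScalarTower.algebraMap_apply])
    (fun σ hσ => hfix (σ.restrictScalars k) hσ)
  have hw0 : w ≠ 0 := by
    rintro rfl
    rw [zero_pow (pow_pos hp.pos e).ne', eq_comm, map_eq_zero] at hw
    exact Units.ne_zero _ hw
  have hwu : Units.mk0 w hw0 ^ p ^ e = f (x / γ) := Units.ext (by simpa [f] using hw)
  have hmem : Units.mk0 w hw0 ^ p ^ e ∈ Γ.map f :=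
    hwu ▸ Subgroup.mem_map_of_mem f (div_mem hx (hle hγ))
  obtain ⟨_, ⟨g, hg, rfl⟩, hgp⟩ := Subgroup.exists_pow_eq_pow_prime_pow hp he
    (hiso _ ⟨_, pow_pos hp.pos e, hmem⟩) hmem
  rw [hwu, ← map_pow] at hgp
  exact ⟨γ, hγ, g, hg, by rw [hf hgp, mul_div_cancel]⟩

theorem sup_le_of_adjoin_roots_eq {k kbar : Type*} [Field k] [CharZero k]
    [Algebra.EssFiniteType ℚ k] [Field kbar] [Algebra k kbar] [IsAlgClosure k kbar]
    {Γ₁ Γ₂ : Subgroup kˣ} (hΓ₁ : Γ₁.FG) (hΓ₂ : Γ₂.FG)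
    (h : ∀ ℓ n : ℕ, ℓ.Prime →
      IntermediateField.adjoin k
        {x : kbar | ∃ γ ∈ Γ₁, x ^ (ℓ ^ n) = algebraMap k kbar (γ : k)} =
      IntermediateField.adjoin k
        {x : kbar | ∃ γ ∈ Γ₂, x ^ (ℓ ^ n) = algebraMap k kbar (γ : k)}) :
    Γ₁ ⊔ Γ₂ ≤ Γ₁ := by
  have : IsAlgClosed kbar := IsAlgClosure.isAlgClosed k
  refine (hΓ₁.sup hΓ₂).le_of_forall_prime_exists_mul_pow fun p hp x hx =>
    exists_eq_mul_pow_of_roots_subset_adjoin (kbar := kbar) le_sup_left (hΓ₁.sup hΓ₂) hp ?_ hx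
  rintro n y ⟨γ, hγ, hy⟩
  obtain ⟨γ₁, hγ₁, γ₂, hγ₂, rfl⟩ := Subgroup.mem_sup.1 hγ
  have hpos : 0 < p ^ n := pow_pos hp.pos n
  obtain ⟨y₁, hy₁⟩ := IsAlgClosed.exists_pow_nat_eq (algebraMap k kbar γ₁) hpos
  have hγ₁0 : algebraMap k kbar γ₁ ≠ 0 := by simp
  have hy₁0 : y₁ ≠ 0 := by
    rintro rfl
    rw [zero_pow hpos.ne'] at hy₁
    exact hγ₁0 hy₁.symm
  have h₁ : y₁ ∈ IntermediateField.adjoin k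
      {x : kbar | ∃ γ ∈ Γ₁, x ^ (p ^ n) = algebraMap k kbar (γ : k)} :=
    IntermediateField.subset_adjoin _ _ ⟨γ₁, hγ₁, hy₁⟩
  have h₂ : y / y₁ ∈ IntermediateField.adjoin k
      {x : kbar | ∃ γ ∈ Γ₁, x ^ (p ^ n) = algebraMap k kbar (γ : k)} := by
    rw [h p n hp]
    refine IntermediateField.subset_adjoin _ _ ⟨γ₂, hγ₂, ?_⟩
    rw [div_pow, hy, hy₁, Units.val_mul, map_mul, mul_div_cancel_left₀ _ hγ₁0]
  simpa [mul_div_cancel₀ _ hy₁0] using mul_mem h₁ h₂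

/-- Let `k` be a field of characteristic `0`, finitely generated as a field
extension of `ℚ` (equivalently: generated over its prime field by a finite set), with algebraic
closure `kbar`.  If two finitely generated subgroups `Γ₁, Γ₂` of `kˣ` satisfy
`k(Γ₁^{1/ℓⁿ}) = k(Γ₂^{1/ℓⁿ})` inside `kbar` for every prime `ℓ` and every `n : ℕ`, then
`Γ₁ = Γ₂`. -/
theorem stmt_0 (k kbar : Type*) [Field k] [CharZero k]
    [Field kbar] [Algebra k kbar] [IsAlgClosure k kbar]
    (hfg : ∃ S : Finset k, Subfield.closure (S : Set k) = ⊤)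
    (Γ₁ Γ₂ : Subgroup kˣ) (hΓ₁ : Γ₁.FG) (hΓ₂ : Γ₂.FG)
    (h : ∀ ℓ n : ℕ, ℓ.Prime →
      IntermediateField.adjoin k
        {x : kbar | ∃ γ ∈ Γ₁, x ^ (ℓ ^ n) = algebraMap k kbar (γ : k)} =
      IntermediateField.adjoin k
        {x : kbar | ∃ γ ∈ Γ₂, x ^ (ℓ ^ n) = algebraMap k kbar (γ : k)}) :
    Γ₁ = Γ₂ := by

  have : Algebra.EssFiniteType ℚ k := by
    obtain ⟨S, hS⟩ := hfg
    refine IntermediateField.fg_top_iff.1 ⟨S, top_unique fun x _ => ?_⟩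
    have hx : x ∈ Subfield.closure (S : Set k) := hS ▸ trivial
    have hle : Subfield.closure (S : Set k) ≤ (IntermediateField.adjoin ℚ (S : Set k)).toSubfield :=
      Subfield.closure_le.2 (IntermediateField.subset_adjoin ℚ (S : Set k))
    exact hle hx
  exact le_antisymm
    (le_sup_right.trans (sup_le_of_adjoin_roots_eq hΓ₂ hΓ₁ fun ℓ n hℓ => (h ℓ n hℓ).symm))
    (le_sup_right.trans (sup_le_of_adjoin_roots_eq hΓ₁ hΓ₂ h))
end

section
/- Let p be a prime number and let k be a field of characteristic p that is finitely generated as a field extension of 𝔽_p, with a fixed algebraic closure k̄. Let Γ₁ and Γ₂ be finitely generated subgroups of k^×. If for every prime number ℓ ≠ p and every natural number n the subfields k(Γ₁^{1/ℓⁿ}) and k(Γ₂^{1/ℓⁿ}) of k̄ coincide, then Γ₁^perf = Γ₂^perf. -/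
open IntermediateField

universe u

/-- An abelian group in which a subgroup `D` is finitely generated as soon as some multiple of each
of its elements lies in a given finitely generated subgroup `N`. -/
def FGSaturations (A : Type*) [AddCommGroup A] : Prop :=
  ∀ N D : Submodule ℤ A, N.FG → (∀ d ∈ D, ∃ r : ℤ, r ≠ 0 ∧ r • d ∈ N) → D.FG

namespace FGSaturations

theorem of_finite (A : Type*) [AddCommGroup A] [Finite A] : FGSaturations A :=
  fun _ _ _ _ => IsNoetherian.noetherian _

theorem of_ker {A B : Type*} [AddCommGroup A] [AddCommGroup B] (ψ : A →ₗ[ℤ] B)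
    (hB : FGSaturations B) (hker : FGSaturations (LinearMap.ker ψ)) : FGSaturations A := by
  intro N D hN hD
  refine Submodule.fg_of_fg_map_of_fg_inf_ker ψ (hB (N.map ψ) _ (hN.map ψ) ?_) ?_
  · rintro _ ⟨d, hd, rfl⟩
    obtain ⟨r, hr, hrd⟩ := hD d hd
    exact ⟨r, hr, r • d, hrd, map_smul ψ r d⟩
  · have : IsNoetherian ℤ N := isNoetherian_of_fg_of_noetherian N hN
    have hN' : (N.comap (LinearMap.ker ψ).subtype).FG := by
      refine Submodule.fg_of_fg_map_injective _ (Submodule.injective_subtype _) ?_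
      have : IsNoetherian ℤ ((N.comap (LinearMap.ker ψ).subtype).map (LinearMap.ker ψ).subtype) :=
        isNoetherian_of_le (Submodule.map_comap_le _ N)
      exact Module.Finite.iff_fg.1 inferInstance
    have hD' := hker _ (D.comap (LinearMap.ker ψ).subtype) hN' fun d hd => hD _ hd
    have := hD'.map (LinearMap.ker ψ).subtype
    rwa [Submodule.map_comap_subtype, inf_comm] at this

theorem of_injective {A B : Type*} [AddCommGroup A] [AddCommGroup B] (f : A →+ B)
    (hf : Function.Injective f) (hB : FGSaturations B) : FGSaturations A := by
  have : Subsingleton (LinearMap.ker f.toIntLinearMap) := by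
    rw [LinearMap.ker_eq_bot.2 hf]
    infer_instance
  exact of_ker f.toIntLinearMap hB (of_finite _)

theorem finsupp_int (ι : Type*) : FGSaturations (ι →₀ ℤ) := by
  rintro _ D ⟨S, rfl⟩ hD
  let T : Set ι := ⋃ s ∈ S, (s.support : Set ι)
  have : Finite T := S.finite_toSet.biUnion fun s _ => Finset.finite_toSet _
  have hS : Submodule.span ℤ (S : Set (ι →₀ ℤ)) ≤ Finsupp.supported ℤ ℤ T := by
    rw [Submodule.span_le]
    exact fun s hs => (Finsupp.mem_supported (M := ℤ) ℤ s).2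
      (Set.subset_biUnion_of_mem (u := fun s : ι →₀ ℤ => (s.support : Set ι)) hs)
  have hDT : D ≤ Finsupp.supported ℤ ℤ T := by
    intro d hd
    obtain ⟨r, hr, hrd⟩ := hD d hd
    have := hS hrd
    rw [Finsupp.mem_supported, Finsupp.support_smul_eq hr] at this
    exact (Finsupp.mem_supported _ _).2 this
  have : IsNoetherian ℤ (Finsupp.supported ℤ ℤ T) :=
    isNoetherian_of_linearEquiv (Finsupp.supportedEquivFinsupp (M := ℤ) (R := ℤ) T).symm
  have : IsNoetherian ℤ D := isNoetherian_of_le hDT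
  exact Module.Finite.iff_fg.1 inferInstance

/-- If up to prime-to-`ℓ` multiples `x` is divisible by arbitrarily large powers of `ℓ` modulo a
finitely generated subgroup `N`, then a prime-to-`ℓ` multiple of `x` lies in `N`. -/
theorem exists_coprime_smul_mem {A : Type*} [AddCommGroup A] (h : FGSaturations A)
    (N : Submodule ℤ A) (hN : N.FG) {ℓ : ℕ} (hℓ : ℓ.Prime) (x : A)
    (hx : ∀ n₀ : ℕ, ∃ n ≥ n₀, ∃ m : ℤ, IsCoprime m ℓ ∧
      ∃ b : A, m • x - (ℓ ^ n : ℤ) • b ∈ N) :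
    ∃ m : ℤ, IsCoprime m ℓ ∧ m • x ∈ N := by
  have hℓ0 : (ℓ : ℤ) ≠ 0 := by exact_mod_cast hℓ.ne_zero
  let N' := N ⊔ Submodule.span ℤ {x}
  let D : Submodule ℤ A :=
    { carrier := {b | ∃ r : ℤ, r ≠ 0 ∧ r • b ∈ N'}
      zero_mem' := ⟨1, one_ne_zero, by simp⟩
      add_mem' := by
        rintro a b ⟨r, hr, hra⟩ ⟨s, hs, hsb⟩
        refine ⟨r * s, mul_ne_zero hr hs, ?_⟩
        rw [smul_add, mul_smul, smul_comm, mul_smul]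
        exact add_mem (N'.smul_mem _ hra) (N'.smul_mem _ hsb)
      smul_mem' := by
        rintro c a ⟨r, hr, hra⟩
        exact ⟨r, hr, by rw [smul_comm]; exact N'.smul_mem _ hra⟩ }
  have hDfg : D.FG := h N' D (hN.sup ⟨{x}, by simp⟩) fun _ hb => hb
  have : Module.Finite ℤ D := Module.Finite.iff_fg.2 hDfg
  have hxN' : x ∈ N' := Submodule.mem_sup_right (Submodule.mem_span_singleton_self x)
  have hxD : x ∈ D := ⟨1, one_ne_zero, by simpa using hxN'⟩
  let Q := D ⧸ N.comap D.subtype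
  let y : Q := Submodule.Quotient.mk ⟨x, hxD⟩
  have hy : y ∈ (⨅ i : ℕ, Ideal.span {(ℓ : ℤ)} ^ i • ⊤ : Submodule ℤ Q) := by
    rw [Submodule.mem_iInf]
    intro i
    obtain ⟨n, hn, m, hm, b, hb⟩ := hx i
    have hbD : b ∈ D := by
      refine ⟨ℓ ^ n, pow_ne_zero _ hℓ0, ?_⟩
      rw [← sub_sub_cancel (m • x) ((ℓ ^ n : ℤ) • b)]
      exact sub_mem (N'.smul_mem _ hxN') (Submodule.mem_sup_left hb)
    have hmy : m • y = (ℓ ^ n : ℤ) • (Submodule.Quotient.mk ⟨b, hbD⟩ : Q) := by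
      rw [← Submodule.Quotient.mk_smul, ← Submodule.Quotient.mk_smul, Submodule.Quotient.eq]
      exact hb
    obtain ⟨u, v, huv⟩ := hm.pow_right (n := n)
    have : y = (ℓ ^ i : ℤ) • ((ℓ ^ (n - i) : ℤ) •
        (u • (Submodule.Quotient.mk ⟨b, hbD⟩ : Q) + v • y)) := by
      rw [smul_smul, ← pow_add, Nat.add_sub_cancel' hn, smul_add, smul_comm _ u, ← hmy,
        smul_smul, smul_smul, ← add_smul, mul_comm _ v, huv, one_smul]
    rw [this, Ideal.span_singleton_pow]
    exact Submodule.smul_mem_smul (Ideal.mem_span_singleton_self _) trivial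
  obtain ⟨⟨r, hr⟩, hry⟩ := (Ideal.mem_iInf_smul_pow_eq_bot_iff _ y).1 hy
  obtain ⟨c, rfl⟩ := Ideal.mem_span_singleton'.1 hr
  refine ⟨1 - c * ℓ, ⟨1, c, by ring⟩, ?_⟩
  have : (1 - c * ℓ) • y = 0 := by rw [sub_smul, one_smul, sub_eq_zero]; exact hry.symm
  rw [← Submodule.Quotient.mk_smul, Submodule.Quotient.mk_eq_zero] at this
  exact this

end FGSaturations

theorem IsIntegral.of_adjoin_singleton_of_adjoin_singleton_inv {k E L : Type*} [Field k]
    [Field E] [Field L] [Algebra k E] [Algebra E L] [Algebra k L] [IsScalarTower k E L] (t : E) (x : L)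
    (h₁ : IsIntegral (Algebra.adjoin k {t}) x) (h₂ : IsIntegral (Algebra.adjoin k {t⁻¹}) x) :
    IsIntegral k x := by
  by_contra hx
  let R := (integralClosure k L).toSubring
  have : IsIntegrallyClosedIn R L :=
    inferInstanceAs (IsIntegrallyClosedIn (integralClosure k L) L)
  obtain ⟨V, hRV, hxV⟩ := Subring.exists_le_valuationSubring_of_isIntegrallyClosedIn (R := R) hx
  have key (s : E) (hs : algebraMap E L s ∈ V) (h : IsIntegral (Algebra.adjoin k {s}) x) :
      x ∈ V := by
    have hA (a : Algebra.adjoin k {s}) : algebraMap E L a ∈ V := by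
      obtain ⟨a, ha⟩ := a
      induction ha using Algebra.adjoin_induction with
      | mem y hy => obtain rfl := hy; exact hs
      | algebraMap r =>
        rw [← IsScalarTower.algebraMap_apply]
        exact hRV isIntegral_algebraMap
      | add y z _ _ hy hz => simpa using add_mem hy hz
      | mul y z _ _ hy hz => simpa using mul_mem hy hz
    let f : Algebra.adjoin k {s} →+* V :=
      (algebraMap (Algebra.adjoin k {s}) L).codRestrict V hA
    obtain ⟨q, hq, hqx⟩ := h
    have : IsIntegral V x :=
      ⟨q.map f, hq.map f, by rw [Polynomial.eval₂_map]; exact hqx⟩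
    obtain ⟨y, rfl⟩ := IsIntegrallyClosed.isIntegral_iff.1 this
    exact y.2
  refine hxV ?_
  rcases V.mem_or_inv_mem (algebraMap E L t) with h | h
  · exact key t h h₁
  · exact key t⁻¹ (by rwa [map_inv₀]) h₂

open scoped nonZeroDivisors in
/-- The divisor map of a Dedekind domain. -/
theorem exists_divisor_hom (B L : Type*) [CommRing B] [IsDedekindDomain B] [Field L]
    [Algebra B L] [IsFractionRing B L] :
    ∃ φ : Additive Lˣ →+ (IsDedekindDomain.HeightOneSpectrum B →₀ ℤ),
      ∀ x : Lˣ, φ (.ofMul x) = 0 → (x : L) ∈ (algebraMap B L).range := by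
  have hne (x : Additive Lˣ) : FractionalIdeal.spanSingleton B⁰ (x.toMul : L) ≠ 0 :=
    FractionalIdeal.spanSingleton_ne_zero_iff.2 x.toMul.ne_zero
  refine ⟨⟨⟨fun x => Finsupp.ofSupportFinite
    (fun v => FractionalIdeal.count L v (FractionalIdeal.spanSingleton B⁰ (x.toMul : L)))
    (FractionalIdeal.finite_factors _), ?_⟩, ?_⟩, ?_⟩
  · ext v
    simp [Finsupp.ofSupportFinite_coe, FractionalIdeal.spanSingleton_one, FractionalIdeal.count_one]
  · intro x y
    ext v
    have := FractionalIdeal.count_mul L v (hne x) (hne y)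
    rw [FractionalIdeal.spanSingleton_mul_spanSingleton] at this
    exact this
  · intro x hx
    have h0 (v) : FractionalIdeal.count L v (FractionalIdeal.spanSingleton B⁰ (x : L)) = 0 :=
      DFunLike.congr_fun hx v
    have h1 := FractionalIdeal.finprod_heightOneSpectrum_factorization' L (hne (.ofMul x))
    simp only [toMul_ofMul, h0, zpow_zero, finprod_one] at h1
    have := FractionalIdeal.mem_spanSingleton_self B⁰ (x : L)
    rw [← h1, FractionalIdeal.mem_one_iff] at this
    exact this

theorem isDedekindDomain_adjoin_singleton {k E : Type*} [Field k] [Field E] [Algebra k E] (t : E) :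
    IsDedekindDomain (Algebra.adjoin k {t}) := by
  let f : Polynomial k →ₐ[k] Algebra.adjoin k {t} :=
    Polynomial.aeval ⟨t, Algebra.self_mem_adjoin_singleton k t⟩
  have hf : Function.Surjective f := by
    rintro ⟨y, hy⟩
    rw [Algebra.adjoin_singleton_eq_range_aeval] at hy
    obtain ⟨q, rfl⟩ := hy
    refine ⟨q, Subtype.ext ?_⟩
    rw [← Subalgebra.coe_val, ← Polynomial.aeval_algHom_apply]
    rfl
  have := IsPrincipalIdealRing.of_surjective f hf
  infer_instance

theorem isFractionRing_adjoin_of_eq_top {k E : Type*} [Field k] [Field E] [Algebra k E] {S : Set E}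
    (h : adjoin k S = ⊤) : IsFractionRing (Algebra.adjoin k S) E :=
  .of_field _ _ fun y => by
    obtain ⟨a, ha, b, hb, hab⟩ := mem_adjoin_iff_div.1 (h ▸ mem_top : y ∈ adjoin k S)
    exact ⟨⟨a, ha⟩, ⟨b, hb⟩, hab⟩

section Simple

variable {k E L : Type u} [Field k] [Field E] [Field L] [Algebra k E] [Algebra E L]
  [FiniteDimensional E L] [Algebra.IsSeparable E L] {t : E}

theorem exists_hom_finsupp_isIntegral (ht : k⟮t⟯ = ⊤) :
    ∃ (ι : Type u) (φ : Additive Lˣ →+ (ι →₀ ℤ)),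
      ∀ x : Lˣ, φ (.ofMul x) = 0 → IsIntegral (Algebra.adjoin k {t}) (x : L) := by
  have := isDedekindDomain_adjoin_singleton (k := k) t
  have := isFractionRing_adjoin_of_eq_top ht
  have := integralClosure.isDedekindDomain (Algebra.adjoin k {t}) E (L := L)
  have : IsFractionRing (integralClosure (Algebra.adjoin k {t}) L) L :=
    integralClosure.isFractionRing_of_finite_extension E L
  obtain ⟨φ, hφ⟩ := exists_divisor_hom (integralClosure (Algebra.adjoin k {t}) L) L
  refine ⟨_, φ, fun x hx => ?_⟩
  obtain ⟨y, hy⟩ := hφ x hx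
  exact hy ▸ y.2

variable [Algebra k L] [IsScalarTower k E L]

/-- The algebraic closure of `k` in a function field over `k` embeds into a finite extension
of `k`, namely the residue field at any place. -/
theorem exists_algebraicClosure_hom_finite (ht : k⟮t⟯ = ⊤) :
    ∃ (F : Type u) (_ : Field F) (_ : Algebra k F),
      FiniteDimensional k F ∧ Nonempty (algebraicClosure k L →+* F) := by
  have := isDedekindDomain_adjoin_singleton (k := k) t
  have := isFractionRing_adjoin_of_eq_top ht
  let B := integralClosure (Algebra.adjoin k {t}) L
  have : Module.Finite (Algebra.adjoin k {t}) B := IsIntegralClosure.finite _ E L B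
  have : Algebra.FiniteType k (Algebra.adjoin k {t}) :=
    (Subalgebra.fg_iff_finiteType _).1 ⟨{t}, by simp⟩
  have : Algebra.FiniteType k B := .trans (S := Algebra.adjoin k {t}) inferInstance inferInstance
  obtain ⟨M, hM⟩ := Ideal.exists_maximal B
  let := Ideal.Quotient.field M
  have : Algebra.FiniteType k (B ⧸ M) :=
    .of_surjective (Ideal.Quotient.mkₐ k M) (Ideal.Quotient.mkₐ_surjective k M)
  refine ⟨B ⧸ M, inferInstance, inferInstance, finite_of_finite_type_of_isJacobsonRing k _,
    ⟨(Ideal.Quotient.mk M).comp ((algebraMap (algebraicClosure k L) L).codRestrict B fun x => ?_)⟩⟩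
  exact (mem_algebraicClosure_iff'.1 x.2).tower_top

theorem FGSaturations.units_of_separable
    (hk : ∀ (F : Type u) [Field F] [Algebra k F] [FiniteDimensional k F],
      FGSaturations (Additive Fˣ)) (ht : k⟮t⟯ = ⊤) :
    FGSaturations (Additive Lˣ) := by
  have ht' : k⟮t⁻¹⟯ = ⊤ := by
    rw [eq_top_iff, ← ht, adjoin_simple_le_iff]
    simpa using inv_mem (mem_adjoin_simple_self k t⁻¹)
  obtain ⟨ι, φ, hφ⟩ := exists_hom_finsupp_isIntegral (L := L) ht
  obtain ⟨κ, φ', hφ'⟩ := exists_hom_finsupp_isIntegral (L := L) ht'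
  obtain ⟨F, _, _, _, ⟨g⟩⟩ := exists_algebraicClosure_hom_finite (L := L) ht
  have hprod : FGSaturations ((ι →₀ ℤ) × (κ →₀ ℤ)) :=
    of_injective Finsupp.sumFinsuppAddEquivProdFinsupp.symm.toAddMonoidHom
      Finsupp.sumFinsuppAddEquivProdFinsupp.symm.injective (finsupp_int (ι ⊕ κ))
  refine of_ker (φ.prod φ').toIntLinearMap hprod ?_
  have hmem (x : LinearMap.ker (φ.prod φ').toIntLinearMap) :
      ((x : Additive Lˣ).toMul : L) ∈ algebraicClosure k L := by
    have hx := Prod.ext_iff.1 x.2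
    exact mem_algebraicClosure_iff'.2
      (.of_adjoin_singleton_of_adjoin_singleton_inv t _ (hφ _ hx.1) (hφ' _ hx.2))
  let f : LinearMap.ker (φ.prod φ').toIntLinearMap →+ Additive (algebraicClosure k L)ˣ :=
    AddMonoidHom.mk' (fun x => .ofMul (Units.mk0 ⟨_, hmem x⟩
      fun h => (x : Additive Lˣ).toMul.ne_zero (congrArg Subtype.val h)))
      fun x y => Units.ext (Subtype.ext rfl)
  have hf : Function.Injective f := fun x y hxy =>
    Subtype.ext (Units.ext (congrArg (fun z : Additive (algebraicClosure k L)ˣ =>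
      ((z.toMul : algebraicClosure k L) : L)) hxy))
  exact of_injective ((Units.map (g : algebraicClosure k L →* F)).toAdditive.comp f)
    ((Units.map_injective g.injective).comp hf) (hk F)

end Simple

theorem FGSaturations.units_of_simple {k E : Type u} [Field k] [Field E] [Algebra k E]
    (hk : ∀ (F : Type u) [Field F] [Algebra k F] [FiniteDimensional k F],
      FGSaturations (Additive Fˣ)) {t : E} (ht : k⟮t⟯ = ⊤)
    (L : Type u) [Field L] [Algebra E L] [FiniteDimensional E L] :
    FGSaturations (Additive Lˣ) := by
  let : Algebra k L := ((algebraMap E L).comp (algebraMap k E)).toAlgebra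
  have : IsScalarTower k E L := .of_algebraMap_eq fun _ => rfl
  let q := ringExpChar E
  have : ExpChar E q := ringExpChar.expChar E
  let L' := separableClosure E L
  have : ExpChar L' q := expChar_of_injective_algebraMap (algebraMap E L').injective q
  let f : L →+* L' := IsPurelyInseparable.iterateFrobenius L' L q le_rfl
  exact of_injective (Units.map (f : L →* L')).toAdditive (Units.map_injective f.injective)
    (units_of_separable (L := L') hk ht)

/-- Finitely generated subgroups of the multiplicative group of a finitely generated field of
positive characteristic have finitely generated saturation. -/
theorem FGSaturations.units_of_fg {k : Type u} [Field k] (p : ℕ) (hp : p.Prime) [CharP k p]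
    (S : Finset k) (hS : Subfield.closure (S : Set k) = ⊤) : FGSaturations (Additive kˣ) := by
  have : Fact p.Prime := ⟨hp⟩
  let := ZMod.algebra k p
  have key := induction_on_adjoin_finset (F := ZMod p) S
    (fun K => ∀ (F : Type u) [Field F] [Algebra K F] [FiniteDimensional K F],
      FGSaturations (Additive Fˣ)) ?_ ?_
  · have htop : adjoin (ZMod p) (S : Set k) = ⊤ := by
      rw [eq_top_iff]
      intro x _
      have : Subfield.closure (S : Set k) ≤ (adjoin (ZMod p) (S : Set k)).toSubfield :=
        Subfield.closure_le.2 (subset_adjoin _ _)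
      exact this (hS ▸ Subfield.mem_top x)
    rw [htop] at key
    have : FiniteDimensional (⊤ : IntermediateField (ZMod p) k) k :=
      Module.Finite.of_surjective (Algebra.linearMap (⊤ : IntermediateField (ZMod p) k) k)
        fun x => ⟨⟨x, mem_top⟩, rfl⟩
    exact key k
  · intro F _ _ _
    have : Finite (⊥ : IntermediateField (ZMod p) k) :=
      Finite.of_equiv _ (botEquiv (ZMod p) k).symm.toEquiv
    have : Finite F := Module.finite_of_finite (⊥ : IntermediateField (ZMod p) k)
    have : Finite (Additive Fˣ) := inferInstanceAs (Finite Fˣ)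
    exact of_finite _
  · intro K x _ hK
    have hgen : adjoin K {AdjoinSimple.gen K x} = ⊤ := by
      apply lift_injective
      rw [lift_adjoin_simple, lift_top, AdjoinSimple.coe_gen]
    exact units_of_simple (E := K⟮x⟯) hK hgen

/-- A sum of `N`-th roots of unity in characteristic `p` is fixed by `p ^ s` when `N ∣ p ^ s - 1`. -/
theorem pow_sum_rootsOfUnity_eq {E ι : Type*} [Field E] (p : ℕ) [ExpChar E p] (s N : ℕ)
    (hN : N ∣ p ^ s - 1) (hp : 0 < p) (t : Finset ι) (ζ : ι → E) (hζ : ∀ i ∈ t, ζ i ^ N = 1) :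
    (∑ i ∈ t, ζ i) ^ p ^ s = ∑ i ∈ t, ζ i := by
  rw [sum_pow_char_pow]
  refine Finset.sum_congr rfl fun i hi => ?_
  obtain ⟨c, hc⟩ := hN
  rw [← Nat.sub_add_cancel (Nat.one_le_pow s p hp), pow_succ, hc, pow_mul, hζ i hi, one_pow,
    one_mul]

/-- Kummer theory without roots of unity in the base field: if some `N`-th root of `x` lies in
`k(Γ^{1/N})`, then `x ^ m` lies in `Γ · (kˣ)^N`, where `N * m = p ^ s - 1`. -/
theorem exists_pow_eq_of_mem_adjoin_roots {k E : Type*} [Field k] [Field E] [Algebra k E]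
    [IsAlgClosed E] (p : ℕ) (hp : p.Prime) [CharP k p] (s N m : ℕ) (hs : N * m = p ^ s - 1)
    (hN : (N : k) ≠ 0) (Γ : Subgroup kˣ) (x : kˣ) (α : E) (hα : α ^ N = algebraMap k E x)
    (hmem : α ∈ adjoin k {y : E | ∃ γ ∈ Γ, y ^ N = algebraMap k E (γ : k)}) :
    ∃ γ ∈ Γ, ∃ b : kˣ, x ^ m = γ * b ^ N := by
  have : CharP E p := charP_of_injective_algebraMap (algebraMap k E).injective p
  have : ExpChar E p := .prime hp
  have hN0 : N ≠ 0 := by rintro rfl; simp at hN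
  obtain ⟨S, hS, hαS⟩ := exists_finset_of_mem_adjoin hmem
  have hsep (y : E) (hy : y ∈ (S : Set E)) : IsSeparable k y := by
    obtain ⟨γ, -, hγ⟩ := hS hy
    exact (Polynomial.separable_X_pow_sub_C (γ : k) hN γ.ne_zero).of_dvd
      (minpoly.dvd k y (by simp [hγ]))
  have : Algebra.IsSeparable k (adjoin k (S : Set E)) := (isSeparable_adjoin_iff_isSeparable k E).2 hsep
  have : FiniteDimensional k (adjoin k (S : Set E)) :=
    finiteDimensional_adjoin fun y hy => (hsep y hy).isIntegral
  set L := adjoin k (S : Set E) with hL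
  have hα0 : α ≠ 0 := by
    rintro rfl
    rw [zero_pow hN0] at hα
    exact x.ne_zero ((map_eq_zero _).1 hα.symm)
  let a : L := ⟨α, hαS⟩
  have ha0 : a ≠ 0 := fun h => hα0 (congrArg Subtype.val h)
  -- the elements of `L` whose `N`-th power lies in `Γ`
  let R : Submonoid L :=
    { carrier := {ρ | ∃ γ ∈ Γ, ρ ^ N = algebraMap k L (γ : k)}
      one_mem' := ⟨1, one_mem _, by simp⟩
      mul_mem' := by
        rintro ρ τ ⟨γ, hγ, h1⟩ ⟨δ, hδ, h2⟩
        exact ⟨γ * δ, mul_mem hγ hδ, by simp [mul_pow, h1, h2]⟩ }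
  have hspan : Submodule.span k (R : Set L) = ⊤ := by
    have h1 : Submonoid.closure (S : Set E) ≤ R.map L.val := by
      rw [Submonoid.closure_le]
      intro y hy
      obtain ⟨γ, hγ, hyγ⟩ := hS hy
      exact ⟨⟨y, subset_adjoin k _ hy⟩, ⟨γ, hγ, Subtype.ext hyγ⟩, rfl⟩
    have h2 : Subalgebra.toSubmodule L.toSubalgebra =
        Submodule.span k (Submonoid.closure (S : Set E)) := by
      rw [hL, adjoin_toSubalgebra_of_isAlgebraic fun y hy => (hsep y hy).isIntegral.isAlgebraic,
        Algebra.adjoin_eq_span]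
    rw [eq_top_iff]
    rintro ⟨y, hy⟩ -
    have h3 : y ∈ Submodule.span k (Submonoid.closure (S : Set E) : Set E) := h2 ▸ hy
    have h4 : y ∈ (Submodule.span k (R : Set L)).map L.val.toLinearMap := by
      rw [Submodule.map_span]
      exact Submodule.span_mono h1 h3
    obtain ⟨z, hz, rfl⟩ := h4
    exact hz
  obtain ⟨ρ, ⟨γ, hγ, hργ⟩, hρ⟩ : ∃ ρ ∈ R, Algebra.trace k L (ρ * a⁻¹) ≠ 0 := by
    by_contra! hcon
    have hzero : Algebra.traceForm k L a⁻¹ = 0 := by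
      refine LinearMap.ext_on hspan fun ρ hρ => ?_
      simpa [Algebra.traceForm_apply, mul_comm] using hcon ρ hρ
    exact inv_ne_zero ha0 ((traceForm_nondegenerate k L).1 _ fun y => by simp [hzero])
  set b := Algebra.trace k L (ρ * a⁻¹)
  have hρ0 : (ρ : E) ≠ 0 := by
    intro h0
    have : ρ = 0 := Subtype.ext h0
    simp [b, this] at hρ
  let ζ (σ : L →ₐ[k] E) : E := σ ρ / ρ * (α / σ a)
  have hpow (σ : L →ₐ[k] E) : ζ σ ^ N = 1 := by
    have h1 : (σ ρ) ^ N = (ρ : E) ^ N := by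
      rw [← map_pow, hργ, AlgHom.commutes]
      exact (congrArg Subtype.val hργ).symm
    have h2 : (σ a) ^ N = α ^ N := by
      have : a ^ N = algebraMap k L x := Subtype.ext hα
      rw [← map_pow, this, AlgHom.commutes, hα]
    simp only [ζ, mul_pow, div_pow, h1, h2]
    rw [div_self (pow_ne_zero _ hρ0), div_self (pow_ne_zero _ hα0), one_mul]
  set η := ∑ σ : L →ₐ[k] E, ζ σ with hη
  have hb : algebraMap k E b = ρ / α * η := by
    rw [hη, Finset.mul_sum, trace_eq_sum_embeddings E]
    refine Finset.sum_congr rfl fun σ _ => ?_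
    simp only [ζ, map_mul, map_inv₀]
    field_simp
  have hη0 : η ≠ 0 := by
    rintro h0
    rw [h0, mul_zero] at hb
    exact hρ ((map_eq_zero _).1 hb)
  have hη1 : η ^ (N * m) = 1 := by
    have h1 := pow_sum_rootsOfUnity_eq p s N ⟨m, hs.symm⟩ hp.pos Finset.univ ζ fun σ _ => hpow σ
    rw [← hη, ← Nat.sub_add_cancel (Nat.one_le_pow s p hp.pos), pow_succ, ← hs] at h1
    exact mul_right_cancel₀ hη0 (h1.trans (one_mul η).symm)
  refine ⟨γ ^ m, pow_mem hγ m, (Units.mk0 b hρ)⁻¹ ^ m, Units.ext ((algebraMap k E).injective ?_)⟩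
  have hργ' : (ρ : E) ^ N = algebraMap k E (γ : k) := congrArg Subtype.val hργ
  have hα' : α = ρ * η * (algebraMap k E b)⁻¹ := by
    rw [hb]; field_simp
  simp only [Units.val_mul, Units.val_pow_eq_pow_val, Units.val_inv_eq_inv_val, Units.val_mk0,
    map_mul, map_pow, map_inv₀, ← hα, ← hργ']
  rw [hα', mul_pow, mul_pow, mul_pow, mul_pow, ← pow_mul η, hη1, mul_one, ← pow_mul _ m,
    ← pow_mul _ N m, mul_comm m N, ← pow_mul]

theorem exists_coprime_zpow_mem {k E : Type*} [Field k] [Field E] [Algebra k E] [IsAlgClosed E]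
    (p : ℕ) (hp : p.Prime) [CharP k p] (hk : FGSaturations (Additive kˣ)) {ℓ : ℕ} (hℓ : ℓ.Prime)
    (hℓp : ℓ ≠ p) (Γ : Subgroup kˣ) (hΓ : Γ.FG) (x : kˣ)
    (h : ∀ (n : ℕ) (α : E), α ^ ℓ ^ n = algebraMap k E (x : k) →
      α ∈ adjoin k {y : E | ∃ γ ∈ Γ, y ^ ℓ ^ n = algebraMap k E (γ : k)}) :
    ∃ m : ℤ, IsCoprime m ℓ ∧ x ^ m ∈ Γ := by
  refine hk.exists_coprime_smul_mem (AddSubgroup.toIntSubmodule Γ.toAddSubgroup)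
    ((Submodule.fg_iff_addSubgroup_fg _).2 ((Subgroup.fg_iff_add_fg Γ).1 hΓ)) hℓ (.ofMul x)
    fun n₀ => ?_
  have hcop : p.Coprime (ℓ ^ n₀) := ((Nat.coprime_primes hp hℓ).2 hℓp.symm).pow_right n₀
  set s := (ℓ ^ n₀).totient with hs
  have hs0 : s ≠ 0 := (Nat.totient_pos.2 (pow_pos hℓ.pos n₀)).ne'
  have hps : 1 < p ^ s := Nat.one_lt_pow hs0 hp.one_lt
  obtain ⟨n, m, hm, hnm⟩ := Nat.exists_eq_pow_mul_and_not_dvd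
    (n := p ^ s - 1) (by omega) ℓ hℓ.ne_one
  have hn : n₀ ≤ n := by
    have hdvd : ℓ ^ n₀ ∣ ℓ ^ n * m :=
      hnm ▸ (Nat.modEq_iff_dvd' hps.le).1 (Nat.ModEq.pow_totient hcop).symm
    exact (Nat.pow_dvd_pow_iff_le_right hℓ.one_lt).1
      (Nat.Coprime.dvd_of_dvd_mul_right
        (Nat.Coprime.pow_left n₀ ((Nat.Prime.coprime_iff_not_dvd hℓ).2 hm)) hdvd)
  have hN : ((ℓ ^ n : ℕ) : k) ≠ 0 := by
    rw [Ne, CharP.cast_eq_zero_iff k p]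
    exact fun hdvd => hℓp ((Nat.prime_dvd_prime_iff_eq hp hℓ).1 (hp.dvd_of_dvd_pow hdvd)).symm
  obtain ⟨α, hα⟩ := IsAlgClosed.exists_pow_nat_eq (algebraMap k E (x : k)) (pow_pos hℓ.pos n)
  obtain ⟨γ, hγ, b, hb⟩ :=
    exists_pow_eq_of_mem_adjoin_roots p hp s (ℓ ^ n) m hnm.symm hN Γ x α hα (h n α hα)
  refine ⟨n, hn, m, (Nat.isCoprime_iff_coprime.2 ((Nat.Prime.coprime_iff_not_dvd hℓ).2 hm)).symm,
    .ofMul b, ?_⟩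
  have hγ' : x ^ (m : ℤ) / b ^ (ℓ ^ n : ℤ) = γ := by
    rw [zpow_natCast, hb, ← Nat.cast_pow, zpow_natCast, mul_div_cancel_right]
  change x ^ (m : ℤ) / b ^ (ℓ ^ n : ℤ) ∈ Γ
  exact hγ' ▸ hγ

/-- If a prime-to-`ℓ` power of `x` lies in `H` for each prime `ℓ ≠ p`, then so does a `p`-power
power of `x`. -/
theorem exists_pow_prime_pow_mem {G : Type*} [CommGroup G] (H : Subgroup G) (p : ℕ) (x : G)
    (h : ∀ ℓ : ℕ, ℓ.Prime → ℓ ≠ p → ∃ m : ℤ, IsCoprime m ℓ ∧ x ^ m ∈ H) :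
    ∃ e : ℕ, x ^ p ^ e ∈ H := by
  have hdvd (ℓ : ℕ) (hℓ : ℓ.Prime) (hord : ℓ ∣ orderOf (x : G ⧸ H)) : ℓ = p := by
    by_contra hne
    obtain ⟨m, hm, hxm⟩ := h ℓ hℓ hne
    have h1 : (orderOf (x : G ⧸ H) : ℤ) ∣ m := by
      rw [orderOf_dvd_iff_zpow_eq_one, ← QuotientGroup.mk_zpow]
      exact (QuotientGroup.eq_one_iff _).2 hxm
    have h2 : IsUnit (ℓ : ℤ) :=
      hm.isUnit_of_dvd' ((Int.natCast_dvd_natCast.2 hord).trans h1) dvd_rfl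
    exact hℓ.ne_one (Int.isUnit_iff_natAbs_eq.1 h2)
  have hord0 : orderOf (x : G ⧸ H) ≠ 0 := by
    intro h0
    obtain ⟨ℓ, hℓ, hprime⟩ := Nat.exists_infinite_primes (p + 1)
    have := hdvd ℓ hprime (h0 ▸ dvd_zero ℓ)
    omega
  have hord := Nat.eq_prime_pow_of_unique_prime_dvd hord0 fun {d} => hdvd d
  refine ⟨(orderOf (x : G ⧸ H)).primeFactorsList.length, (QuotientGroup.eq_one_iff _).1 ?_⟩
  rw [QuotientGroup.mk_pow, ← hord, pow_orderOf_eq_one]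

theorem perf_subset_of_adjoin_roots_le {p : ℕ} (hp : p.Prime) {k E : Type*} [Field k] [CharP k p]
    [Field E] [Algebra k E] [IsAlgClosed E] (hk : FGSaturations (Additive kˣ))
    (Γ Δ : Subgroup kˣ) (hΓ : Γ.FG)
    (h : ∀ ℓ n : ℕ, ℓ.Prime → ℓ ≠ p →
      adjoin k {x : E | ∃ γ ∈ Δ, x ^ (ℓ ^ n) = algebraMap k E (γ : k)} ≤
      adjoin k {x : E | ∃ γ ∈ Γ, x ^ (ℓ ^ n) = algebraMap k E (γ : k)}) :
    {x : E | ∃ n : ℕ, ∃ γ ∈ Δ, x ^ (p ^ n) = algebraMap k E (γ : k)} ⊆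
    {x : E | ∃ n : ℕ, ∃ γ ∈ Γ, x ^ (p ^ n) = algebraMap k E (γ : k)} := by
  rintro y ⟨n, x, hx, hy⟩
  obtain ⟨e, he⟩ := exists_pow_prime_pow_mem Γ p x fun ℓ hℓ hℓp =>
    exists_coprime_zpow_mem (E := E) p hp hk hℓ hℓp Γ hΓ x fun n α hα =>
      h ℓ n hℓ hℓp (subset_adjoin k _ ⟨x, hx, hα⟩)
  exact ⟨n + e, _, he, by rw [pow_add, pow_mul, hy, Units.val_pow_eq_pow_val, map_pow]⟩

/-- Let `p` be a prime and `k` a field of characteristic `p`, finitely generated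
as a field extension of `𝔽_p` (equivalently: generated over its prime field by a finite set),
with algebraic closure `kbar`.  If two finitely generated subgroups `Γ₁, Γ₂` of `kˣ` satisfy
`k(Γ₁^{1/ℓⁿ}) = k(Γ₂^{1/ℓⁿ})` inside `kbar` for every prime `ℓ ≠ p` and every `n : ℕ`, then
`Γ₁^perf = Γ₂^perf` (as subsets of `kbar`). -/
theorem stmt_1 (p : ℕ) (hp : p.Prime) (k kbar : Type*) [Field k] [CharP k p]
    [Field kbar] [Algebra k kbar] [IsAlgClosure k kbar]
    (hfg : ∃ S : Finset k, Subfield.closure (S : Set k) = ⊤)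
    (Γ₁ Γ₂ : Subgroup kˣ) (hΓ₁ : Γ₁.FG) (hΓ₂ : Γ₂.FG)
    (h : ∀ ℓ n : ℕ, ℓ.Prime → ℓ ≠ p →
      IntermediateField.adjoin k
        {x : kbar | ∃ γ ∈ Γ₁, x ^ (ℓ ^ n) = algebraMap k kbar (γ : k)} =
      IntermediateField.adjoin k
        {x : kbar | ∃ γ ∈ Γ₂, x ^ (ℓ ^ n) = algebraMap k kbar (γ : k)}) :
    {x : kbar | ∃ n : ℕ, ∃ γ ∈ Γ₁, x ^ (p ^ n) = algebraMap k kbar (γ : k)} =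
    {x : kbar | ∃ n : ℕ, ∃ γ ∈ Γ₂, x ^ (p ^ n) = algebraMap k kbar (γ : k)} := by
  have := IsAlgClosure.isAlgClosed (K := kbar) k
  obtain ⟨S, hS⟩ := hfg
  have hk := FGSaturations.units_of_fg p hp S hS
  exact (perf_subset_of_adjoin_roots_le hp hk Γ₂ Γ₁ hΓ₂ fun ℓ n hℓ hℓp => (h ℓ n hℓ hℓp).le).antisymm
    (perf_subset_of_adjoin_roots_le hp hk Γ₁ Γ₂ hΓ₁ fun ℓ n hℓ hℓp => (h ℓ n hℓ hℓp).ge)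
end

section
/- Let k be a number field and let λ₁, λ₂ ∈ k with λ₁, λ₂ ∉ {0, 1}. For λ ∈ k \ {0,1}, let Γ(λ) denote the subgroup of k^× generated by the set of pairwise differences {a − b : a, b ∈ {0, 1, λ}, a ≠ b}. Suppose (i) Γ(λ₁) = Γ(λ₂), and (ii) no element of J(λ₁) belongs to 𝓔. Then J(λ₁) = J(λ₂) as subsets of k. -/
/-- `J(λ) = {λ, 1/λ, 1−λ, 1/(1−λ), λ/(λ−1), (λ−1)/λ}`. -/
def Jset (k : Type*) [Field k] (lam : k) : Set k :=
  {lam, lam⁻¹, 1 - lam, (1 - lam)⁻¹, lam / (lam - 1), (lam - 1) / lam}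

/-- `e ∈ 𝓔` : both `e` and `e⁻¹` are integral over `ℤ`, and `1 - e` divides `2` in the ring of
all algebraic integers (i.e. `2/(1-e)` is integral over `ℤ`). -/
def memE {k : Type*} [Field k] (e : k) : Prop :=
  IsIntegral ℤ e ∧ IsIntegral ℤ e⁻¹ ∧ ∃ c : k, IsIntegral ℤ c ∧ (1 - e) * c = 2

/-- `Γ(λ)` : the subgroup of `kˣ` generated by the pairwise differences of elements of
`{0, 1, λ}`. -/
def GammaSet (k : Type*) [Field k] (lam : k) : Subgroup kˣ :=
  Subgroup.closure
    {u : kˣ | ∃ a ∈ ({0, 1, lam} : Set k), ∃ b ∈ ({0, 1, lam} : Set k), a ≠ b ∧ (u : k) = a - b}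

open IsDedekindDomain NumberField

section Field

variable {k : Type*} [Field k]

/-- `x` equals `± λ^a (1 - λ)^b` for some integers `a` and `b`. -/
def IsSignedMonomial (lam x : k) : Prop :=
  ∃ e : k, (e = 1 ∨ e = -1) ∧ ∃ a b : ℤ, x = e * (lam ^ a * (1 - lam) ^ b)

/-- `λ, 1 - λ` and `μ, 1 - μ` are signed monomials in each other. -/
structure IsLinked (lam mu : k) : Prop where
  left : IsSignedMonomial lam mu
  left_sub : IsSignedMonomial lam (1 - mu)
  right : IsSignedMonomial mu lam
  right_sub : IsSignedMonomial mu (1 - lam)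

lemma isSign_ne_zero {e : k} (he : e = 1 ∨ e = -1) : e ≠ 0 := by
  rcases he with rfl | rfl <;> simp

lemma isSign_mul {e f : k} (he : e = 1 ∨ e = -1) (hf : f = 1 ∨ f = -1) :
    e * f = 1 ∨ e * f = -1 := by
  rcases he with rfl | rfl <;> rcases hf with rfl | rfl <;> simp

lemma isSign_zpow {e : k} (he : e = 1 ∨ e = -1) (n : ℤ) : e ^ n = 1 ∨ e ^ n = -1 := by
  rcases he with rfl | rfl
  · simp
  · rcases Int.even_or_odd n with h | h
    · exact Or.inl h.neg_one_zpow
    · exact Or.inr h.neg_one_zpow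

lemma IsSignedMonomial.mul {lam x y : k} (h0 : lam ≠ 0) (h1 : 1 - lam ≠ 0)
    (hx : IsSignedMonomial lam x) (hy : IsSignedMonomial lam y) :
    IsSignedMonomial lam (x * y) := by
  obtain ⟨e, he, a, b, rfl⟩ := hx
  obtain ⟨f, hf, c, d, rfl⟩ := hy
  refine ⟨e * f, isSign_mul he hf, a + c, b + d, ?_⟩
  rw [zpow_add₀ h0, zpow_add₀ h1]
  ring

lemma IsSignedMonomial.zpow {lam x : k} (hx : IsSignedMonomial lam x) (n : ℤ) :
    IsSignedMonomial lam (x ^ n) := by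
  obtain ⟨e, he, a, b, rfl⟩ := hx
  refine ⟨e ^ n, isSign_zpow he n, a * n, b * n, ?_⟩
  rw [mul_zpow, mul_zpow, zpow_mul, zpow_mul]

lemma IsSignedMonomial.of_sign {lam e : k} (he : e = 1 ∨ e = -1) : IsSignedMonomial lam e :=
  ⟨e, he, 0, 0, by simp⟩

lemma IsSignedMonomial.self (lam : k) : IsSignedMonomial lam lam :=
  ⟨1, Or.inl rfl, 1, 0, by simp⟩

lemma IsSignedMonomial.one_sub_self (lam : k) : IsSignedMonomial lam (1 - lam) :=
  ⟨1, Or.inl rfl, 0, 1, by simp⟩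

lemma IsSignedMonomial.trans {lam mu x : k} (h0 : lam ≠ 0) (h1 : 1 - lam ≠ 0)
    (hmu : IsSignedMonomial lam mu) (hmu' : IsSignedMonomial lam (1 - mu))
    (hx : IsSignedMonomial mu x) : IsSignedMonomial lam x := by
  obtain ⟨e, he, a, b, rfl⟩ := hx
  exact (IsSignedMonomial.of_sign he).mul h0 h1 ((hmu.zpow a).mul h0 h1 (hmu'.zpow b))

lemma IsLinked.symm {lam mu : k} (h : IsLinked lam mu) : IsLinked mu lam :=
  ⟨h.right, h.right_sub, h.left, h.left_sub⟩

lemma IsLinked.trans {lam mu nu : k} (h0 : lam ≠ 0) (h1 : 1 - lam ≠ 0)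
    (hn0 : nu ≠ 0) (hn1 : 1 - nu ≠ 0) (h : IsLinked lam mu) (h' : IsLinked mu nu) :
    IsLinked lam nu :=
  ⟨h.left.trans h0 h1 h.left_sub h'.left, h.left.trans h0 h1 h.left_sub h'.left_sub,
    h'.right.trans hn0 hn1 h'.right_sub h.right, h'.right.trans hn0 hn1 h'.right_sub h.right_sub⟩

lemma isLinked_one_sub (lam : k) : IsLinked lam (1 - lam) := by
  refine ⟨.one_sub_self lam, ?_, ?_, .self _⟩
  · simpa using IsSignedMonomial.self lam
  · simpa using IsSignedMonomial.one_sub_self (1 - lam)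

lemma one_sub_inv {lam : k} (h0 : lam ≠ 0) : 1 - lam⁻¹ = -1 * (lam⁻¹ * (1 - lam)) := by
  field_simp
  ring

lemma one_sub_div_sub_one {lam : k} (h1 : 1 - lam ≠ 0) :
    1 - lam / (lam - 1) = (1 - lam)⁻¹ := by
  have : lam - 1 ≠ 0 := by rwa [← neg_sub, neg_ne_zero]
  field_simp
  ring

lemma div_sub_one_eq {lam : k} : lam / (lam - 1) = -1 * (lam * (1 - lam)⁻¹) := by
  rw [← neg_sub 1 lam, div_neg, div_eq_mul_inv]
  ring

lemma isLinked_inv {lam : k} (h0 : lam ≠ 0) : IsLinked lam lam⁻¹ :=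
  ⟨⟨1, Or.inl rfl, -1, 0, by simp⟩, ⟨-1, Or.inr rfl, -1, 1, by simpa using one_sub_inv h0⟩,
    ⟨1, Or.inl rfl, -1, 0, by simp⟩,
    ⟨-1, Or.inr rfl, -1, 1, by simpa using one_sub_inv (inv_ne_zero h0)⟩⟩

lemma isLinked_div_sub_one {lam : k} (h1 : 1 - lam ≠ 0) : IsLinked lam (lam / (lam - 1)) := by
  have h : 1 - lam / (lam - 1) = (1 - lam)⁻¹ := one_sub_div_sub_one h1
  refine ⟨⟨-1, Or.inr rfl, 1, -1, by simpa using div_sub_one_eq (lam := lam)⟩,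
    ⟨1, Or.inl rfl, 0, -1, by simpa using h⟩, ⟨-1, Or.inr rfl, 1, -1, ?_⟩,
    ⟨1, Or.inl rfl, 0, -1, by simp [h]⟩⟩
  rw [h, div_sub_one_eq]
  simp [h1]

lemma Jset_eq_of_mem {lam mu : k} (h0 : lam ≠ 0) (h1 : 1 - lam ≠ 0) (h : mu ∈ Jset k lam) :
    Jset k mu = Jset k lam := by
  have h1' : lam - 1 ≠ 0 := by rwa [← neg_sub, neg_ne_zero]
  have i1 : 1 - lam⁻¹ = (lam - 1) / lam := by field_simp
  have i2 : 1 - (1 - lam)⁻¹ = lam / (lam - 1) := by field_simp; ring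
  have i3 : 1 - lam / (lam - 1) = (1 - lam)⁻¹ := one_sub_div_sub_one h1
  have i4 : 1 - (lam - 1) / lam = lam⁻¹ := by field_simp; ring
  have j1 : lam⁻¹ / (lam⁻¹ - 1) = (1 - lam)⁻¹ := by
    rw [← neg_sub, i1]; field_simp; ring
  have j2 : (1 - lam) / (1 - lam - 1) = (lam - 1) / lam := by
    rw [show 1 - lam - 1 = -lam by ring]; field_simp; ring
  have j3 : (1 - lam)⁻¹ / ((1 - lam)⁻¹ - 1) = lam⁻¹ := by
    rw [← neg_sub 1 (1 - lam)⁻¹, i2]; field_simp; ring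
  have j4 : lam / (lam - 1) / (lam / (lam - 1) - 1) = lam := by
    rw [← neg_sub 1 (lam / (lam - 1)), i3]; field_simp; ring
  have j5 : (lam - 1) / lam / ((lam - 1) / lam - 1) = 1 - lam := by
    rw [← neg_sub 1 ((lam - 1) / lam), i4]; field_simp; ring
  have swap : (mu - 1) / mu = (mu / (mu - 1))⁻¹ := (inv_div _ _).symm
  have e1 : (lam / (lam - 1))⁻¹ = (lam - 1) / lam := inv_div _ _
  have e2 : ((lam - 1) / lam)⁻¹ = lam / (lam - 1) := inv_div _ _
  simp only [Jset, Set.mem_insert_iff, Set.mem_singleton_iff] at h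
  ext x
  rw [Jset, swap]
  rcases h with rfl | rfl | rfl | rfl | rfl | rfl
  · rw [inv_div, Jset]
  all_goals
    simp only [Jset, Set.mem_insert_iff, Set.mem_singleton_iff, i1, i2, i3, i4, j1, j2, j3,
      j4, j5, e1, e2, inv_inv, sub_sub_cancel]
    tauto

lemma isSignedMonomial_of_mem_GammaSet {lam : k} (h0 : lam ≠ 0) (h1 : 1 - lam ≠ 0) {u : kˣ}
    (hu : u ∈ GammaSet k lam) : IsSignedMonomial lam (u : k) := by
  induction hu using Subgroup.closure_induction with
  | mem x hx =>
    obtain ⟨a, ha, b, hb, hab, hx⟩ := hx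
    rw [hx]
    simp only [Set.mem_insert_iff, Set.mem_singleton_iff] at ha hb
    rcases ha with rfl | rfl | rfl <;> rcases hb with rfl | rfl | rfl
    any_goals exact absurd rfl hab
    · exact ⟨-1, Or.inr rfl, 0, 0, by simp⟩
    · exact ⟨-1, Or.inr rfl, 1, 0, by simp⟩
    · exact ⟨1, Or.inl rfl, 0, 0, by simp⟩
    · exact ⟨1, Or.inl rfl, 0, 1, by simp⟩
    · exact ⟨1, Or.inl rfl, 1, 0, by simp⟩
    · exact ⟨-1, Or.inr rfl, 0, 1, by simp⟩
  | one => exact .of_sign (Or.inl rfl)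
  | mul x y _ _ hx hy => simpa using hx.mul h0 h1 hy
  | inv x _ hx => simpa using hx.zpow (-1)

lemma isLinked_of_GammaSet_eq {lam mu : k} (h0 : lam ≠ 0) (h1 : 1 - lam ≠ 0)
    (hm0 : mu ≠ 0) (hm1 : 1 - mu ≠ 0) (h : GammaSet k lam = GammaSet k mu) :
    IsLinked lam mu := by
  have self {x : k} (hx : x ≠ 0) : Units.mk0 x hx ∈ GammaSet k x :=
    Subgroup.subset_closure ⟨x, by simp, 0, by simp, hx, by simp⟩
  have sub {x : k} (hx : 1 - x ≠ 0) : Units.mk0 (1 - x) hx ∈ GammaSet k x :=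
    Subgroup.subset_closure ⟨1, by simp, x, by simp, sub_ne_zero.1 hx, by simp⟩
  exact ⟨isSignedMonomial_of_mem_GammaSet h0 h1 (h ▸ self hm0),
    isSignedMonomial_of_mem_GammaSet h0 h1 (h ▸ sub hm1),
    isSignedMonomial_of_mem_GammaSet hm0 hm1 (h ▸ self h0),
    isSignedMonomial_of_mem_GammaSet hm0 hm1 (h ▸ sub h1)⟩

end Field

section NumberField

variable {k : Type*} [Field k] [NumberField k]

/-- The additive `v`-adic valuation, with junk value `0` at `0`. -/
noncomputable def ordAt (v : HeightOneSpectrum (𝓞 k)) (x : k) : ℤ :=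
  -WithZero.log (v.valuation k x)

lemma ordAt_mul (v : HeightOneSpectrum (𝓞 k)) {x y : k} (hx : x ≠ 0) (hy : y ≠ 0) :
    ordAt v (x * y) = ordAt v x + ordAt v y := by
  rw [ordAt, map_mul, WithZero.log_mul (by simpa using hx) (by simpa using hy), neg_add]
  rfl

lemma ordAt_zpow (v : HeightOneSpectrum (𝓞 k)) (x : k) (n : ℤ) :
    ordAt v (x ^ n) = n * ordAt v x := by
  simp [ordAt, map_zpow₀, WithZero.log_zpow]

lemma ordAt_inv (v : HeightOneSpectrum (𝓞 k)) (x : k) : ordAt v x⁻¹ = -ordAt v x := by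
  simp [ordAt, WithZero.log_inv]

lemma ordAt_sign (v : HeightOneSpectrum (𝓞 k)) {e : k} (he : e = 1 ∨ e = -1) :
    ordAt v e = 0 := by
  rcases he with rfl | rfl <;> simp [ordAt, Valuation.map_neg]

lemma ordAt_monomial (v : HeightOneSpectrum (𝓞 k)) {e x y : k} (he : e = 1 ∨ e = -1)
    (hx : x ≠ 0) (hy : y ≠ 0) (a b : ℤ) :
    ordAt v (e * (x ^ a * y ^ b)) = a * ordAt v x + b * ordAt v y := by
  rw [ordAt_mul v (isSign_ne_zero he) (mul_ne_zero (zpow_ne_zero _ hx) (zpow_ne_zero _ hy)),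
    ordAt_mul v (zpow_ne_zero _ hx) (zpow_ne_zero _ hy), ordAt_sign v he, ordAt_zpow, ordAt_zpow,
    zero_add]

lemma ordAt_div_sub_one (v : HeightOneSpectrum (𝓞 k)) {lam : k} (h0 : lam ≠ 0)
    (h1 : 1 - lam ≠ 0) : ordAt v (lam / (lam - 1)) = ordAt v lam - ordAt v (1 - lam) := by
  have := ordAt_monomial v (Or.inr rfl : (-1 : k) = 1 ∨ (-1 : k) = -1) h0 h1 1 (-1)
  rw [div_sub_one_eq, ← zpow_neg_one (1 - lam)]
  simp only [zpow_one] at this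
  rw [this]
  ring

lemma valuation_lt_one_iff (v : HeightOneSpectrum (𝓞 k)) {x : k} (hx : x ≠ 0) :
    v.valuation k x < 1 ↔ 0 < ordAt v x := by
  rw [ordAt, ← WithZero.log_lt_log (by simpa using hx) one_ne_zero, WithZero.log_one]
  omega

lemma one_lt_valuation_iff (v : HeightOneSpectrum (𝓞 k)) {x : k} (hx : x ≠ 0) :
    1 < v.valuation k x ↔ ordAt v x < 0 := by
  rw [ordAt, ← WithZero.log_lt_log one_ne_zero (by simpa using hx), WithZero.log_one]
  omega

/-- The pair `(v(λ), v(1 - λ))` lies on one of the rays spanned by `(1,0)`, `(0,1)`, `(-1,-1)`. -/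
lemma ordAt_trichotomy (v : HeightOneSpectrum (𝓞 k)) {x : k} (h0 : x ≠ 0) (h1 : 1 - x ≠ 0) :
    (0 ≤ ordAt v x ∧ ordAt v (1 - x) = 0) ∨ (ordAt v x = 0 ∧ 0 ≤ ordAt v (1 - x)) ∨
      (ordAt v x = ordAt v (1 - x) ∧ ordAt v x ≤ 0) := by
  have pos {y : k} (hy : y ≠ 0) (h : 0 < ordAt v y) : ordAt v (1 - y) = 0 := by
    rw [ordAt, Valuation.map_one_sub_of_lt _ ((valuation_lt_one_iff v hy).2 h)]
    simp
  have neg {y : k} (hy : y ≠ 0) (h : ordAt v y < 0) : ordAt v (1 - y) = ordAt v y := by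
    rw [ordAt, Valuation.map_sub_eq_of_lt_right _ (by
      rw [map_one]; exact (one_lt_valuation_iff v hy).2 h), ordAt]
  have hp := pos h0
  have hn := neg h0
  have hn' := neg h1
  rw [sub_sub_cancel] at hn'
  omega

lemma isIntegral_of_ordAt_nonneg {x : k} (hx : x ≠ 0)
    (h : ∀ v : HeightOneSpectrum (𝓞 k), 0 ≤ ordAt v x) : IsIntegral ℤ x := by
  obtain ⟨y, rfl⟩ := HeightOneSpectrum.mem_integers_of_valuation_le_one (R := 𝓞 k) k x
    fun v => not_lt.1 fun hv => (not_lt.2 (h v)) ((one_lt_valuation_iff v hx).1 hv)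
  exact RingOfIntegers.isIntegral_coe y

/-- A primitive vector with a positive multiple on one of the three rays generates that ray. -/
lemma exponents_of_ray {a c m p q : ℤ} (hm : 0 < m)
    (hac : (0 ≤ a * m ∧ c * m = 0) ∨ (a * m = 0 ∧ 0 ≤ c * m) ∨ (a * m = c * m ∧ a * m ≤ 0))
    (h1 : p * a + q * c = 1) :
    (a = 1 ∧ c = 0) ∨ (a = 0 ∧ c = 1) ∨ (a = -1 ∧ c = -1) := by
  rcases hac with ⟨h, h'⟩ | ⟨h', h⟩ | ⟨h', h⟩
  · obtain rfl : c = 0 := by simpa [hm.ne'] using h'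
    have ha : 0 ≤ a := nonneg_of_mul_nonneg_left h hm
    exact Or.inl ⟨Int.eq_one_of_mul_eq_one_left (a := p) ha (by linarith), rfl⟩
  · obtain rfl : a = 0 := by simpa [hm.ne'] using h'
    have hc : 0 ≤ c := nonneg_of_mul_nonneg_left h hm
    exact Or.inr (Or.inl ⟨rfl, Int.eq_one_of_mul_eq_one_left (a := q) hc (by linarith)⟩)
  · obtain rfl : a = c := mul_right_cancel₀ hm.ne' h'
    have ha : 0 ≤ -a := by nlinarith
    have := Int.eq_one_of_mul_eq_one_left (a := -(p + q)) ha (by linarith)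
    omega

lemma mem_Jset_of_two_rays {lam mu : k} (h0 : lam ≠ 0) (h1 : 1 - lam ≠ 0) (hm0 : mu ≠ 0)
    (hm1 : 1 - mu ≠ 0) (h : IsLinked lam mu)
    (hv : ∃ v : HeightOneSpectrum (𝓞 k), 0 < ordAt v lam)
    (hw : ∃ w : HeightOneSpectrum (𝓞 k), 0 < ordAt w (1 - lam)) : mu ∈ Jset k lam := by
  obtain ⟨v, hv⟩ := hv
  obtain ⟨w, hw⟩ := hw
  obtain ⟨⟨e, he, a, b, hmu⟩, ⟨f, hf, c, d, hmu'⟩, ⟨e', he', p, q, hlam⟩,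
    ⟨f', hf', r, s, hlam'⟩⟩ := h
  have hv1 : ordAt v (1 - lam) = 0 := by have := ordAt_trichotomy v h0 h1; omega
  have hw1 : ordAt w lam = 0 := by have := ordAt_trichotomy w h0 h1; omega
  have va : ordAt v mu = a * ordAt v lam := by
    conv_lhs => rw [hmu, ordAt_monomial v he h0 h1, hv1]
    ring
  have vc : ordAt v (1 - mu) = c * ordAt v lam := by
    conv_lhs => rw [hmu', ordAt_monomial v hf h0 h1, hv1]
    ring
  have wb : ordAt w mu = b * ordAt w (1 - lam) := by
    conv_lhs => rw [hmu, ordAt_monomial w he h0 h1, hw1]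
    ring
  have wd : ordAt w (1 - mu) = d * ordAt w (1 - lam) := by
    conv_lhs => rw [hmu', ordAt_monomial w hf h0 h1, hw1]
    ring
  have vl : ordAt v lam = p * ordAt v mu + q * ordAt v (1 - mu) := by
    conv_lhs => rw [hlam, ordAt_monomial v he' hm0 hm1]
  have wl : ordAt w lam = p * ordAt w mu + q * ordAt w (1 - mu) := by
    conv_lhs => rw [hlam, ordAt_monomial w he' hm0 hm1]
  have wl' : ordAt w (1 - lam) = r * ordAt w mu + s * ordAt w (1 - mu) := by
    conv_lhs => rw [hlam', ordAt_monomial w hf' hm0 hm1]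
  have tv := ordAt_trichotomy v hm0 hm1
  have tw := ordAt_trichotomy w hm0 hm1
  rw [va, vc] at tv vl
  rw [wb, wd] at tw wl wl'
  rw [hw1] at wl
  have hpa : p * a + q * c = 1 := mul_right_cancel₀ hv.ne' (by linarith)
  have hpb : p * b + q * d = 0 := mul_right_cancel₀ hw.ne' (by linarith)
  have hrb : r * b + s * d = 1 := mul_right_cancel₀ hw.ne' (by linarith)
  have hne : ¬ (a = b ∧ c = d) := by
    rintro ⟨rfl, rfl⟩
    omega
  have hac := exponents_of_ray hv tv hpa
  have hbd := exponents_of_ray hw tw hrb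
  have hs : e * (lam ^ a * (1 - lam) ^ b) + f * (lam ^ c * (1 - lam) ^ d) = 1 := by
    rw [← hmu, ← hmu']; ring
  have two : (2 : k) ≠ 0 := two_ne_zero
  have hsub : lam - 1 = -(1 - lam) := by ring
  clear hmu' hlam hlam' tv tw va vc wb wd vl wl wl'
  simp only [Jset, Set.mem_insert_iff, Set.mem_singleton_iff, hsub, hmu]
  rcases hac with ⟨rfl, rfl⟩ | ⟨rfl, rfl⟩ | ⟨rfl, rfl⟩ <;>
  rcases hbd with ⟨rfl, rfl⟩ | ⟨rfl, rfl⟩ | ⟨rfl, rfl⟩ <;>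
  first
  | exact absurd ⟨rfl, rfl⟩ hne
  | rcases he with rfl | rfl <;> rcases hf with rfl | rfl <;>
    simp only [zpow_neg, zpow_one, zpow_zero, one_mul, mul_one, neg_mul] at hs ⊢ <;>
    grind

/-- Two numbers of absolute value one at the same distance from `1` are equal or inverse. -/
lemma Complex.eq_or_eq_inv_of_norm_one_sub_eq {z w : ℂ} (hz : ‖z‖ = 1) (hw : ‖w‖ = 1)
    (h : ‖1 - w‖ = ‖1 - z‖) : w = z ∨ w = z⁻¹ := by
  have sq (x : ℂ) (hx : ‖x‖ = 1) : x.re * x.re + x.im * x.im = 1 := by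
    rw [← Complex.normSq_apply, Complex.normSq_eq_norm_sq, hx, one_pow]
  have hz' := sq z hz
  have hw' := sq w hw
  have hn : Complex.normSq (1 - w) = Complex.normSq (1 - z) := by
    rw [Complex.normSq_eq_norm_sq, Complex.normSq_eq_norm_sq, h]
  simp only [Complex.normSq_apply, Complex.sub_re, Complex.sub_im, Complex.one_re,
    Complex.one_im] at hn
  have hre : w.re = z.re := by nlinarith
  have him : w.im = z.im ∨ w.im = -z.im := by
    rw [← sq_eq_sq_iff_eq_or_eq_neg]
    nlinarith
  rcases him with him | him
  · exact Or.inl (Complex.ext hre him)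
  · refine Or.inr ?_
    rw [Complex.inv_eq_conj hz]
    exact Complex.ext hre him

/-- The case of units `λ, μ` that are powers of each other up to sign. -/
lemma eq_or_eq_inv_of_unit {lam mu e f g : k} (h0 : lam ≠ 0)
    (he : e = 1 ∨ e = -1) (hf : f = 1 ∨ f = -1) (hg : g = 1 ∨ g = -1)
    {a c p : ℤ} (hmu : mu = e * lam ^ a) (hmu' : 1 - mu = f * (lam ^ c * (1 - lam)))
    (hlam : lam = g * mu ^ p) (hu : ∀ v : HeightOneSpectrum (𝓞 k), ordAt v lam = 0)
    (hE : ¬ memE lam) : mu = lam ∨ mu = lam⁻¹ := by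
  have hint (n : ℤ) : IsIntegral ℤ (lam ^ n) :=
    isIntegral_of_ordAt_nonneg (zpow_ne_zero _ h0) fun v => by rw [ordAt_zpow, hu, mul_zero]
  have hsgn {s : k} (hs : s = 1 ∨ s = -1) : IsIntegral ℤ s := by
    rcases hs with rfl | rfl
    · exact isIntegral_one
    · exact isIntegral_one.neg
  have hpow : lam = g * e ^ p * lam ^ (a * p) := by
    conv_lhs => rw [hlam, hmu, mul_zpow, ← zpow_mul]
    ring
  by_cases hap : a * p = 1
  · have hdvd (n : ℤ) (s : k) (hs : s = 1 ∨ s = -1) (h : 1 + lam = s * (lam ^ n * (1 - lam))) :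
        memE lam := by
      refine ⟨by simpa using hint 1, by simpa using hint (-1), 1 + s * lam ^ n,
        isIntegral_one.add ((hsgn hs).mul (hint n)), ?_⟩
      linear_combination -h
    rcases Int.eq_one_or_neg_one_of_mul_eq_one hap with rfl | rfl
    · rcases he with rfl | rfl
      · left; simpa using hmu
      · refine absurd (hdvd c f hf ?_) hE
        rw [← hmu', hmu]; simp
    · rcases he with rfl | rfl
      · right; simpa using hmu
      · refine absurd (hdvd (c + 1) f hf ?_) hE
        rw [zpow_add₀ h0, zpow_one]
        have hmul : mu * lam = -1 := by rw [hmu]; simp [h0]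
        linear_combination lam * hmu' + hmul
  · obtain ⟨φ⟩ : Nonempty (k →+* ℂ) := inferInstance
    have hφ {s : k} (hs : s = 1 ∨ s = -1) : ‖φ s‖ = 1 := by
      rcases hs with rfl | rfl <;> simp
    have hnl : ‖φ lam‖ = 1 := by
      have hn : ‖φ lam‖ = ‖φ lam‖ ^ (a * p) := by
        conv_lhs => rw [hpow]
        rw [map_mul, norm_mul, hφ (isSign_mul hg (isSign_zpow he p)), map_zpow₀, norm_zpow, one_mul]
      have hpos : 0 < ‖φ lam‖ := by simpa using h0
      by_contra hne
      exact hap (zpow_right_injective₀ hpos hne (by simpa using hn.symm))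
    have hnm : ‖φ mu‖ = 1 := by
      rw [hmu, map_mul, norm_mul, hφ he, map_zpow₀, norm_zpow, hnl]; simp
    have hd : ‖1 - φ mu‖ = ‖1 - φ lam‖ := by
      have := congrArg (fun x => ‖φ x‖) hmu'
      simpa [hφ hf, hnl] using this
    rcases Complex.eq_or_eq_inv_of_norm_one_sub_eq hnl hnm hd with h | h
    · exact Or.inl (φ.injective h)
    · exact Or.inr (φ.injective (by rw [h, map_inv₀]))

lemma mem_Jset_of_unit {lam mu : k} (h0 : lam ≠ 0) (h1 : 1 - lam ≠ 0) (hm0 : mu ≠ 0)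
    (hm1 : 1 - mu ≠ 0) (h : IsLinked lam mu)
    (hu : ∀ v : HeightOneSpectrum (𝓞 k), ordAt v lam = 0) (hE : ¬ memE lam) :
    mu ∈ Jset k lam := by
  obtain ⟨w, hw⟩ : ∃ w : HeightOneSpectrum (𝓞 k), 0 < ordAt w (1 - lam) := by
    by_contra! hneg
    refine hE ⟨isIntegral_of_ordAt_nonneg h0 fun v => (hu v).ge,
      isIntegral_of_ordAt_nonneg (inv_ne_zero h0) fun v => by simp [ordAt_inv, hu v],
      (1 - lam)⁻¹ * 2, .mul (isIntegral_of_ordAt_nonneg (inv_ne_zero h1) fun v => ?_) ?_,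
      mul_inv_cancel_left₀ h1 2⟩
    · have := hneg v
      rw [ordAt_inv]
      omega
    · simpa using isIntegral_algebraMap (R := ℤ) (A := k) (x := 2)
  obtain ⟨⟨e, he, a, b, hmu⟩, ⟨f, hf, c, d, hmu'⟩, ⟨e', he', p, q, hlam⟩,
    ⟨f', hf', r, s, hlam'⟩⟩ := h
  have wb : ordAt w mu = b * ordAt w (1 - lam) := by
    conv_lhs => rw [hmu, ordAt_monomial w he h0 h1, hu]
    ring
  have wd : ordAt w (1 - mu) = d * ordAt w (1 - lam) := by
    conv_lhs => rw [hmu', ordAt_monomial w hf h0 h1, hu]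
    ring
  have wl : 0 = p * ordAt w mu + q * ordAt w (1 - mu) := by
    rw [← hu w]
    conv_lhs => rw [hlam, ordAt_monomial w he' hm0 hm1]
  have wl' : ordAt w (1 - lam) = r * ordAt w mu + s * ordAt w (1 - mu) := by
    conv_lhs => rw [hlam', ordAt_monomial w hf' hm0 hm1]
  have tw := ordAt_trichotomy w hm0 hm1
  rw [wb, wd] at tw wl wl'
  have hpb : p * b + q * d = 0 := mul_right_cancel₀ hw.ne' (by linarith)
  have hrb : r * b + s * d = 1 := mul_right_cancel₀ hw.ne' (by linarith)
  have hJ {nu : k} (h : nu = lam ∨ nu = lam⁻¹) : nu ∈ Jset k lam := by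
    rcases h with rfl | rfl <;> simp [Jset]
  rcases exponents_of_ray hw tw hrb with ⟨rfl, rfl⟩ | ⟨rfl, rfl⟩ | ⟨rfl, rfl⟩
  · obtain rfl : p = 0 := by omega
    have hmem : 1 - mu ∈ Jset k lam := hJ <| eq_or_eq_inv_of_unit h0 hf he he'
      (by simpa using hmu') (by simpa using hmu) (by simpa using hlam) hu hE
    rw [← Jset_eq_of_mem h0 h1 hmem]
    simp [Jset]
  · obtain rfl : q = 0 := by omega
    exact hJ <| eq_or_eq_inv_of_unit h0 he hf he'
      (by simpa using hmu) (by simpa using hmu') (by simpa using hlam) hu hE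
  · obtain rfl : q = -p := by omega
    have hneg : (-1 : k) = 1 ∨ (-1 : k) = -1 := Or.inr rfl
    have hf1 : f⁻¹ = f := by rcases hf with rfl | rfl <;> simp
    have hmem : mu / (mu - 1) ∈ Jset k lam := by
      refine hJ <| eq_or_eq_inv_of_unit (a := a - c) (c := -c) (p := p) h0
        (isSign_mul hneg (isSign_mul he hf)) hf (isSign_mul he' (isSign_zpow hneg p))
        ?_ ?_ ?_ hu hE
      · rw [div_sub_one_eq, hmu', hmu, zpow_sub₀ h0]
        simp only [mul_inv, hf1, zpow_neg, zpow_one, inv_inv]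
        field_simp
      · rw [one_sub_div_sub_one hm1, hmu']
        simp only [mul_inv, hf1, zpow_neg, zpow_one, inv_inv]
      · conv_lhs => rw [hlam]
        rw [div_sub_one_eq, mul_assoc, ← mul_zpow, ← mul_assoc (-1 : k), zpow_neg, ← inv_zpow,
          ← mul_zpow]
        simp
    rw [← Jset_eq_of_mem h0 h1 hmem, Jset_eq_of_mem (lam := mu) hm0 hm1 (by simp [Jset])]
    simp [Jset]

theorem mem_Jset_of_isLinked {lam mu : k} (h0 : lam ≠ 0) (h1 : 1 - lam ≠ 0) (hm0 : mu ≠ 0)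
    (hm1 : 1 - mu ≠ 0) (h : IsLinked lam mu) (hE : ∀ nu ∈ Jset k lam, ¬ memE nu) :
    mu ∈ Jset k lam := by
  have h1' : lam - 1 ≠ 0 := by rwa [← neg_sub, neg_ne_zero]
  have hd0 : lam / (lam - 1) ≠ 0 := div_ne_zero h0 h1'
  have hd : 1 - lam / (lam - 1) = (1 - lam)⁻¹ := one_sub_div_sub_one h1
  have hd1 : 1 - lam / (lam - 1) ≠ 0 := hd ▸ inv_ne_zero h1
  have hi1 : 1 - lam⁻¹ ≠ 0 := by
    rw [one_sub_inv h0]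
    simp [h0, h1]
  have memd : lam / (lam - 1) ∈ Jset k lam := by simp [Jset]
  have memi : lam⁻¹ ∈ Jset k lam := by simp [Jset]
  have mems : 1 - lam ∈ Jset k lam := by simp [Jset]
  have linkd := (isLinked_div_sub_one h1).symm.trans hd0 hd1 hm0 hm1 h
  have tri := fun v => ordAt_trichotomy (k := k) v h0 h1
  by_cases hA : ∃ v : HeightOneSpectrum (𝓞 k), 0 < ordAt v lam
  · by_cases hB : ∃ v : HeightOneSpectrum (𝓞 k), 0 < ordAt v (1 - lam)
    · exact mem_Jset_of_two_rays h0 h1 hm0 hm1 h hA hB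
    by_cases hC : ∃ v : HeightOneSpectrum (𝓞 k), ordAt v lam < 0
    · obtain ⟨v, hv⟩ := hA
      obtain ⟨w, hw⟩ := hC
      rw [← Jset_eq_of_mem h0 h1 memd]
      refine mem_Jset_of_two_rays hd0 hd1 hm0 hm1 linkd ⟨v, ?_⟩ ⟨w, ?_⟩
      · rw [ordAt_div_sub_one v h0 h1]
        have := tri v
        omega
      · rw [hd, ordAt_inv]
        have := tri w
        omega
    · push Not at hB hC
      rw [← Jset_eq_of_mem h0 h1 mems]
      refine mem_Jset_of_unit h1 (by simpa using h0) hm0 hm1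
        ((isLinked_one_sub lam).symm.trans h1 (by simpa using h0) hm0 hm1 h) (fun v => ?_)
        (hE _ mems)
      have := tri v
      have := hB v
      have := hC v
      omega
  · by_cases hC : ∃ v : HeightOneSpectrum (𝓞 k), ordAt v lam < 0
    · by_cases hB : ∃ v : HeightOneSpectrum (𝓞 k), 0 < ordAt v (1 - lam)
      · obtain ⟨v, hv⟩ := hC
        obtain ⟨w, hw⟩ := hB
        rw [← Jset_eq_of_mem h0 h1 memi]
        refine mem_Jset_of_two_rays (inv_ne_zero h0) hi1 hm0 hm1
          ((isLinked_inv h0).symm.trans (inv_ne_zero h0) hi1 hm0 hm1 h) ⟨v, ?_⟩ ⟨w, ?_⟩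
        · rw [ordAt_inv]
          omega
        · have hw' := ordAt_monomial w (Or.inr rfl : (-1 : k) = 1 ∨ (-1 : k) = -1) h0 h1 (-1) 1
          rw [zpow_neg_one, zpow_one] at hw'
          rw [one_sub_inv h0, hw']
          have := tri w
          omega
      · push Not at hA hB
        rw [← Jset_eq_of_mem h0 h1 memd]
        refine mem_Jset_of_unit hd0 hd1 hm0 hm1 linkd (fun v => ?_) (hE _ memd)
        rw [ordAt_div_sub_one v h0 h1]
        have := tri v
        have := hA v
        have := hB v
        omega
    · push Not at hA hC
      exact mem_Jset_of_unit h0 h1 hm0 hm1 h (fun v => le_antisymm (hA v) (hC v))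
        (hE _ (by simp [Jset]))

end NumberField

/-- For `λ₁, λ₂ ∈ k ∖ {0,1}` in a number field `k`, if `Γ(λ₁) = Γ(λ₂)` and no
element of `J(λ₁)` lies in `𝓔`, then `J(λ₁) = J(λ₂)`. -/
theorem stmt_2 (k : Type*) [Field k] [NumberField k]
    (lam1 lam2 : k) (h10 : lam1 ≠ 0) (h11 : lam1 ≠ 1) (h20 : lam2 ≠ 0) (h21 : lam2 ≠ 1)
    (hGamma : GammaSet k lam1 = GammaSet k lam2)
    (hE : ∀ μ ∈ Jset k lam1, ¬ memE μ) :
    Jset k lam1 = Jset k lam2 := by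
  have h11' : 1 - lam1 ≠ 0 := sub_ne_zero.2 h11.symm
  have h21' : 1 - lam2 ≠ 0 := sub_ne_zero.2 h21.symm
  exact (Jset_eq_of_mem h10 h11' (mem_Jset_of_isLinked h10 h11' h20 h21'
    (isLinked_of_GammaSet_eq h10 h11' h20 h21' hGamma) hE)).symm
end

section
/- Let R be an integral domain that is finitely generated as a ℤ-algebra. Then the group of units R^× is a finitely generated abelian group. -/
open IsDedekindDomain

universe u v

section FG

/-- An abelian group is finitely generated when it maps to a finitely generated abelian group
with kernel embedding in a finitely generated abelian group. -/
theorem Group.fg_of_ker_injective {G H N : Type*} [CommGroup G] [CommGroup H] [CommGroup N]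
    [Group.FG H] [Group.FG N] (f : G →* H) (g : f.ker →* N) (hg : Function.Injective g) :
    Group.FG G := by
  have hH : Module.Finite ℤ (Additive H) := Module.Finite.iff_addGroup_fg.mpr inferInstance
  have hN : Module.Finite ℤ (Additive N) := Module.Finite.iff_addGroup_fg.mpr inferInstance
  let φ : Additive G →ₗ[ℤ] Additive H := f.toAdditive.toIntLinearMap
  let ψ : LinearMap.ker φ →ₗ[ℤ] Additive N :=
    AddMonoidHom.toIntLinearMap
      { toFun := fun x ↦ Additive.ofMul (g ⟨x.1.toMul, x.2⟩)
        map_zero' := map_one g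
        map_add' := fun x y ↦ map_mul g ⟨x.1.toMul, x.2⟩ ⟨y.1.toMul, y.2⟩ }
  have hψ : Function.Injective ψ := fun x y h ↦
    Subtype.ext (congrArg (fun z : f.ker ↦ Additive.ofMul z.1) (hg h))
  have : IsNoetherian ℤ (LinearMap.ker φ) := isNoetherian_of_injective ψ hψ
  have : IsNoetherian ℤ (Additive G) :=
    isNoetherian_of_range_eq_ker (LinearMap.ker φ).subtype φ (Submodule.range_subtype _)
  rw [GroupFG.iff_add_fg, ← Module.Finite.iff_addGroup_fg]
  infer_instance

theorem Group.fg_of_injective {G H : Type*} [CommGroup G] [CommGroup H] [Group.FG H]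
    (f : G →* H) (hf : Function.Injective f) : Group.FG G :=
  Group.fg_of_ker_injective (1 : G →* Unit) (f.comp (Subgroup.subtype _))
    (hf.comp Subtype.val_injective)

end FG

section Valuations

variable {L : Type u} [Field L]

/-- A valuation subring containing the image of `D` contains every element integral over `D`. -/
theorem ValuationSubring.mem_of_isIntegral {D : Type*} [CommRing D] [Algebra D L]
    (V : ValuationSubring L) (hV : ∀ d : D, algebraMap D L d ∈ V) {x : L} (hx : IsIntegral D x) :
    x ∈ V := by
  let g : D →+* V := (algebraMap D L).codRestrict V hV
  have hVx : IsIntegral V x := by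
    obtain ⟨p, hp, hpx⟩ := hx
    refine ⟨p.map g, hp.map g, ?_⟩
    rw [Polynomial.eval₂_map]
    exact hpx
  exact LocalSubring.mem_of_isMax_of_isIntegral V.isMax_toLocalSubring hVx

/-- The valuation subrings of a finite separable extension of `Frac D` which contain `D` and in
which a fixed nonzero `f : D` is not invertible are jointly controlled by finitely many
integer-valued valuations. -/
theorem exists_hom_of_isSeparable (D F : Type*) [CommRing D] [IsDedekindDomain D]
    [Field F] [Algebra D F] [IsFractionRing D F] [Algebra D L] [Algebra F L] [IsScalarTower D F L]
    [FiniteDimensional F L] [Algebra.IsSeparable F L] {f : D} (hf : f ≠ 0) :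
    ∃ (ι : Type u) (_ : Finite ι) (φ : Lˣ →* (ι → Multiplicative ℤ)), ∀ u : Lˣ, φ u = 1 →
      ∀ V : ValuationSubring L, (∀ d : D, algebraMap D L d ∈ V) → (algebraMap D L f)⁻¹ ∉ V →
        (u : L) ∈ V := by
  let B := integralClosure D L
  have : IsDedekindDomain B := integralClosure.isDedekindDomain D F L
  have : IsFractionRing B L := integralClosure.isFractionRing_of_finite_extension F L
  have hDL : Function.Injective (algebraMap D L) := by
    rw [IsScalarTower.algebraMap_eq D F L]
    exact (algebraMap F L).injective.comp (IsFractionRing.injective D F)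
  have hfL : algebraMap D L f ≠ 0 := (map_ne_zero_iff _ hDL).mpr hf
  have hfB : algebraMap D B f ≠ 0 := fun h ↦ hfL (by
    rw [IsScalarTower.algebraMap_apply D B L, h, map_zero])
  let S : Set (HeightOneSpectrum B) := {P | P.asIdeal ∣ Ideal.span {algebraMap D B f}}
  have hS : S.Finite := Ideal.finite_factors (by simpa using hfB)
  refine ⟨S, hS, MonoidHom.pi fun P ↦ P.1.valuationOfNeZero, fun u hu V hV hfV ↦ ?_⟩
  have hBV : ∀ b : B, (b : L) ∈ V := fun b ↦ V.mem_of_isIntegral hV b.2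
  let g : B →+* V := (algebraMap B L).codRestrict V hBV
  let P : Ideal B := (IsLocalRing.maximalIdeal V).comap g
  have hmem (b : B) (hb : b ∉ P) : (b : L)⁻¹ ∈ V := by
    have : IsUnit (g b) := by simpa [P] using hb
    obtain ⟨c, hc⟩ := this.exists_right_inv
    have : (b : L) * (c : L) = 1 := congrArg Subtype.val hc
    rw [inv_eq_of_mul_eq_one_right this]
    exact c.2
  have hfP : algebraMap D B f ∈ P := by
    by_contra h
    exact hfV (hmem _ h)
  let Q : HeightOneSpectrum B := ⟨P, Ideal.IsPrime.comap g, fun h ↦ hfB (by simpa [h] using hfP)⟩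
  have hQ : Q ∈ S := by simpa [S, Ideal.dvd_span_singleton] using hfP
  have hval : Q.valuation L (u : L) ≤ 1 := by
    rw [← HeightOneSpectrum.valuationOfNeZero_eq]
    have := congrFun hu ⟨Q, hQ⟩
    simp only [MonoidHom.pi_apply, Pi.one_apply] at this
    rw [this, WithZero.coe_one]
  obtain ⟨n, d, h⟩ := Q.exists_primeCompl_mul_eq_of_integer (u : L) hval
  have hd : (d.1 : L) ≠ 0 := fun h0 ↦ d.2 (by
    rw [show d.1 = 0 from Subtype.ext h0]; exact Q.asIdeal.zero_mem)
  rw [← eq_mul_inv_iff_mul_eq₀ (by exact hd)] at h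
  rw [h]
  exact mul_mem (hBV n) (hmem d.1 d.2)

/-- The separability assumption in `exists_hom_of_isSeparable` is superfluous. -/
theorem exists_hom_of_finiteDimensional (D F : Type*) [CommRing D] [IsDedekindDomain D]
    [Field F] [Algebra D F] [IsFractionRing D F] [Algebra D L] [Algebra F L] [IsScalarTower D F L]
    [FiniteDimensional F L] {f : D} (hf : f ≠ 0) :
    ∃ (ι : Type u) (_ : Finite ι) (φ : Lˣ →* (ι → Multiplicative ℤ)), ∀ u : Lˣ, φ u = 1 →
      ∀ V : ValuationSubring L, (∀ d : D, algebraMap D L d ∈ V) → (algebraMap D L f)⁻¹ ∉ V →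
        (u : L) ∈ V := by
  let E := separableClosure F L
  obtain ⟨ι, hι, φ, hφ⟩ := exists_hom_of_isSeparable (L := E) D F hf
  let q := ringExpChar E ^ IsPurelyInseparable.exponent E L
  have hq : q ≠ 0 := pow_ne_zero _ (expChar_pos E (ringExpChar E)).ne'
  have hpow (x : L) : ∃ y : E, (y : L) = x ^ q := IsPurelyInseparable.exponent_def E x
  choose r hr using hpow
  let ρ : L →* E :=
    { toFun := r
      map_one' := Subtype.ext (by simp [hr])
      map_mul' := fun x y ↦ Subtype.ext (by simp [hr, mul_pow]) }
  refine ⟨ι, hι, φ.comp (Units.map ρ), fun u hu V hV hfV ↦ ?_⟩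
  have := hφ (Units.map ρ u) hu (V.comap (algebraMap E L)) hV hfV
  have h : (u : L) ^ q ∈ V := by
    rw [← hr]; exact this
  exact V.mem_of_isIntegral (D := V) (fun d ↦ d.2) (.of_pow (Nat.pos_of_ne_zero hq)
    (isIntegral_algebraMap (x := (⟨_, h⟩ : V))))

/-- Membership of `x` in the valuation subrings over `C` is controlled by finitely many discrete
valuations: an element of `Lˣ` on which these vanish lies in each valuation subring which contains
`C` but not `x`. -/
def HasFinitelyManyPoles (C : Type*) [CommRing C] [Algebra C L] (x : L) : Prop :=
  ∃ (ι : Type u) (_ : Finite ι) (φ : Lˣ →* (ι → Multiplicative ℤ)), ∀ u : Lˣ, φ u = 1 →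
    ∀ V : ValuationSubring L, (∀ c : C, algebraMap C L c ∈ V) → x ∉ V → (u : L) ∈ V

theorem HasFinitelyManyPoles.of_isIntegral {C : Type*} [CommRing C] [Algebra C L] {x : L}
    (hx : IsIntegral C x) : HasFinitelyManyPoles C x :=
  ⟨PEmpty, inferInstance, 1, fun _ _ V hV hxV ↦ (hxV (V.mem_of_isIntegral hV hx)).elim⟩

/-- An element contained in all valuation subrings over `C` is integral over `C`. -/
theorem isIntegral_of_forall_mem_valuationSubring {C : Type*} [CommRing C] [Algebra C L] {x : L}
    (hx : ∀ V : ValuationSubring L, (∀ c : C, algebraMap C L c ∈ V) → x ∈ V) : IsIntegral C x := by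
  have h : x ∈ ⨅ V : {V : ValuationSubring L //
      Set.range (algebraMap C L) ⊆ V.toSubring}, V.1.toSubring := by
    rw [Subring.mem_iInf]
    exact fun V ↦ hx V.1 fun c ↦ V.2 ⟨c, rfl⟩
  rw [iInf_valuationSubring_superset, ← RingHom.coe_range, Subring.closure_eq] at h
  obtain ⟨p, hp, hpx⟩ := h
  obtain ⟨q, hq, -, hqm⟩ := Polynomial.lifts_and_degree_eq_and_monic
    (f := (algebraMap C L).rangeRestrict) (p := p)
    (Polynomial.mem_lifts p |>.mpr
      (Polynomial.map_surjective _ (algebraMap C L).rangeRestrict_surjective p)) hp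
  refine ⟨q, hqm, ?_⟩
  rw [← hq, Polynomial.eval₂_map] at hpx
  exact hpx

/-- The units of a finitely generated subring, modulo those integral over `C`, embed in a finitely
generated free abelian group. -/
theorem exists_hom_units_closure (C : Type*) [CommRing C] [Algebra C L] {X : Set L}
    (hX : X.Finite) (hC : ∀ x ∈ X, HasFinitelyManyPoles C x) :
    ∃ (ι : Type u) (_ : Finite ι) (φ : (Subring.closure X)ˣ →* (ι → Multiplicative ℤ)),
      ∀ u, φ u = 1 → IsIntegral C (u : L) := by
  have hC' (x : X) := hC x x.2
  choose ι hι φ hφ using hC'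
  have : Finite X := hX
  let ψ : Lˣ →* ((Σ x : X, ι x) → Multiplicative ℤ) :=
    MonoidHom.pi fun i ↦ (Pi.evalMonoidHom _ i.2).comp (φ i.1)
  refine ⟨Σ x : X, ι x, inferInstance,
    ψ.comp (Units.map (Subring.closure X).subtype.toMonoidHom), fun u hu ↦ ?_⟩
  refine isIntegral_of_forall_mem_valuationSubring fun V hV ↦ ?_
  by_cases hXV : X ⊆ V
  · exact (Subring.closure_le (t := V.toSubring)).mpr hXV u.1.2
  · obtain ⟨x, hx, hxV⟩ := Set.not_subset.mp hXV
    exact hφ ⟨x, hx⟩ (Units.map (Subring.closure X).subtype.toMonoidHom u)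
      (funext fun i ↦ congrFun hu ⟨⟨x, hx⟩, i⟩) V hV hxV

theorem HasFinitelyManyPoles.of_numberField [NumberField L] (x : L) :
    HasFinitelyManyPoles ℤ x := by
  obtain ⟨n, hn, hx⟩ := ((IsFractionRing.isAlgebraic_iff ℤ ℚ L).mpr
    (Algebra.IsAlgebraic.isAlgebraic (R := ℚ) x)).exists_integral_multiple
  obtain ⟨ι, hι, φ, hφ⟩ := exists_hom_of_finiteDimensional (L := L) ℤ ℚ hn
  refine ⟨ι, hι, φ, fun u hu V hV hxV ↦ hφ u hu V hV fun h ↦ hxV ?_⟩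
  have hn' : algebraMap ℤ L n ≠ 0 := by simpa using hn
  have := mul_mem h (V.mem_of_isIntegral hV hx)
  rwa [Algebra.smul_def, inv_mul_cancel_left₀ hn'] at this

end Valuations

section Trdeg

open IntermediateField IntermediateField.algebraAdjoinAdjoin

variable {K : Type v} {L : Type u} [Field K] [Field L] [Algebra K L]

theorem Transcendental.trdeg_adjoin {x : L} (hx : Transcendental K x) :
    Algebra.trdeg K K⟮x⟯ = 1 := by
  have hD : Algebra.trdeg K (Algebra.adjoin K {x}) = 1 := by
    have e := (AlgEquiv.ofInjective _ (transcendental_iff_injective.mp hx)).trans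
      (Subalgebra.equivOfEq _ _ (Algebra.adjoin_singleton_eq_range_aeval K x).symm)
    have := e.lift_trdeg_eq
    rw [Polynomial.trdeg_of_isDomain] at this
    simpa using this.symm
  have : Algebra.IsAlgebraic (Algebra.adjoin K {x}) K⟮x⟯ :=
    IsLocalization.isAlgebraic _ (nonZeroDivisors (Algebra.adjoin K {x}))
  rw [← trdeg_add_eq K (Algebra.adjoin K {x}) (A := K⟮x⟯), hD, trdeg_eq_zero, add_zero]

theorem Transcendental.trdeg_eq_add_one {x : L} (hx : Transcendental K x) :
    Algebra.trdeg K L = Algebra.trdeg K⟮x⟯ L + 1 := by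
  rw [← trdeg_add_eq K K⟮x⟯ (A := L), hx.trdeg_adjoin, add_comm]

theorem Transcendental.finiteDimensional_adjoin [Algebra.EssFiniteType K L]
    (hKL : Algebra.trdeg K L ≤ 1) {x : L} (hx : Transcendental K x) :
    FiniteDimensional K⟮x⟯ L := by
  have : Algebra.EssFiniteType K⟮x⟯ L := .of_comp K K⟮x⟯ L
  have : Algebra.IsAlgebraic K⟮x⟯ L := by
    rw [← trdeg_eq_zero_iff]
    rw [hx.trdeg_eq_add_one] at hKL
    have : Algebra.trdeg K⟮x⟯ L + 1 ≤ 0 + 1 := by simpa using hKL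
    simpa using Cardinal.add_le_add_iff_of_lt_aleph0 Cardinal.one_lt_aleph0 |>.mp this
  exact Algebra.finite_of_essFiniteType_of_isAlgebraic

theorem HasFinitelyManyPoles.of_trdeg_le_one [Algebra.EssFiniteType K L]
    (hKL : Algebra.trdeg K L ≤ 1) (x : L) : HasFinitelyManyPoles K x := by
  by_cases hx : IsIntegral K x
  · exact .of_isIntegral hx
  have hx' : Transcendental K x⁻¹ := fun h ↦ hx (by simpa using h.inv.isIntegral)
  have := hx'.finiteDimensional_adjoin hKL
  let D := Algebra.adjoin K {x⁻¹}
  have : IsPrincipalIdealRing D := by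
    let e := (AlgEquiv.ofInjective _ (transcendental_iff_injective.mp hx')).trans
      (Subalgebra.equivOfEq _ _ (Algebra.adjoin_singleton_eq_range_aeval K x⁻¹).symm)
    exact IsPrincipalIdealRing.of_surjective e.toRingEquiv.toRingHom e.surjective
  let f : D := ⟨x⁻¹, Algebra.self_mem_adjoin_singleton K x⁻¹⟩
  have hf : f ≠ 0 := fun h ↦ hx' (by
    rw [show x⁻¹ = 0 from congrArg Subtype.val h]; exact isAlgebraic_zero)
  obtain ⟨ι, hι, φ, hφ⟩ := exists_hom_of_finiteDimensional (L := L) D K⟮x⁻¹⟯ hf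
  refine ⟨ι, hι, φ, fun u hu V hV hxV ↦ hφ u hu V ?_ ?_⟩
  · have hxV' : x⁻¹ ∈ V := (V.mem_or_inv_mem x).resolve_left hxV
    rintro ⟨d, hd⟩
    change d ∈ V
    induction hd using Algebra.adjoin_induction with
    | mem y hy => rwa [Set.mem_singleton_iff.mp hy]
    | algebraMap r => exact hV r
    | add _ _ _ _ h₁ h₂ => exact add_mem h₁ h₂
    | mul _ _ _ _ h₁ h₂ => exact mul_mem h₁ h₂
  · simpa [f] using hxV

end Trdeg

/-- Every finitely generated subring has a finitely generated group of units. -/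
def HasFGUnits (L : Type*) [Field L] : Prop :=
  ∀ X : Set L, X.Finite → Group.FG (Subring.closure X)ˣ

theorem HasFGUnits.of_finite (L : Type*) [Field L] [Finite L] : HasFGUnits L :=
  fun _ _ ↦ inferInstance

theorem HasFGUnits.of_numberField (L : Type*) [Field L] [NumberField L] : HasFGUnits L := by
  intro X hX
  obtain ⟨ι, hι, φ, hφ⟩ := exists_hom_units_closure ℤ hX
    fun x _ ↦ HasFinitelyManyPoles.of_numberField x
  let g : φ.ker →* NumberField.RingOfIntegers L :=
    { toFun := fun u ↦ ⟨u.1, hφ u.1 u.2⟩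
      map_one' := rfl
      map_mul' := fun _ _ ↦ rfl }
  have : Group.FG (NumberField.RingOfIntegers L)ˣ := Group.fg_iff_monoid_fg.mpr inferInstance
  refine Group.fg_of_ker_injective φ g.toHomUnits fun u v h ↦ ?_
  have h' : g u = g v := congrArg Units.val h
  exact Subtype.ext (Units.ext (Subtype.ext
    (congrArg (algebraMap (NumberField.RingOfIntegers L) L) h')))

theorem HasFGUnits.of_trdeg_le_one (K : Type*) {L : Type u} [Field K] [Field L] [Algebra K L]
    [Algebra.EssFiniteType K L] (hKL : Algebra.trdeg K L ≤ 1)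
    (hK : ∀ (K' : Type u) [Field K'] [Algebra K K'] [FiniteDimensional K K'], HasFGUnits K') :
    HasFGUnits L := by
  intro X hX
  obtain ⟨ι, hι, φ, hφ⟩ := exists_hom_units_closure K hX
    fun x _ ↦ HasFinitelyManyPoles.of_trdeg_le_one hKL x
  let A := Algebra.adjoin K X
  have : Algebra.FiniteType K A := (Subalgebra.fg_iff_finiteType _).mp ⟨hX.toFinset, by simp [A]⟩
  obtain ⟨M, hM⟩ := Ideal.exists_maximal A
  let : Field (A ⧸ M) := Ideal.Quotient.field M
  have : FiniteDimensional K (A ⧸ M) := finite_of_finite_type_of_isJacobsonRing K (A ⧸ M)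
  let X' : Set (A ⧸ M) := Ideal.Quotient.mk M '' (Subtype.val ⁻¹' X)
  have hX' : X'.Finite := (hX.preimage Subtype.val_injective.injOn).image _
  have hXA : Subring.closure X ≤ A.toSubring :=
    Subring.closure_le.mpr Algebra.subset_adjoin
  let q : Subring.closure X →+* A ⧸ M := (Ideal.Quotient.mk M).comp (Subring.inclusion hXA)
  have hq (r : Subring.closure X) : q r ∈ Subring.closure X' := by
    have : Subring.closure X ≤
        ((Subring.closure X').comap (Ideal.Quotient.mk M)).map A.val.toRingHom :=
      Subring.closure_le.mpr fun x hx ↦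
        ⟨⟨x, Algebra.subset_adjoin hx⟩, Subring.subset_closure ⟨_, hx, rfl⟩, rfl⟩
    obtain ⟨a, ha, har⟩ := this r.2
    have : Subring.inclusion hXA r = a := Subtype.ext har.symm
    change Ideal.Quotient.mk M (Subring.inclusion hXA r) ∈ _
    exact this ▸ ha
  let g := Units.map (q.codRestrict (Subring.closure X') hq).toMonoidHom
  have := hK (A ⧸ M) X' hX'
  refine Group.fg_of_ker_injective φ (g.comp φ.ker.subtype) ?_
  rw [injective_iff_map_eq_one]
  intro u hu
  have hu1 : q u.1 = 1 := congrArg (fun z ↦ (z.1 : A ⧸ M)) hu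
  let a : A := Subring.inclusion hXA u.1 - 1
  have ha : a ∈ M := by
    rw [← Ideal.Quotient.eq_zero_iff_mem, map_sub, map_one, sub_eq_zero]
    exact hu1
  have hai : IsIntegral K (a : L) := (hφ u.1 u.2).sub isIntegral_one
  have ha0 : (a : L) = 0 := by
    by_contra h0
    refine hM.ne_top (M.eq_top_of_isUnit_mem ha ?_)
    exact IsUnit.of_mul_eq_one ⟨(a : L)⁻¹, hai.inv_mem a.2⟩ (Subtype.ext (mul_inv_cancel₀ h0))
  exact Subtype.ext (Units.ext (Subtype.ext (sub_eq_zero.mp ha0)))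

open IntermediateField in
/-- If all finite extensions of `K` have finitely generated unit groups of finitely generated
subrings, then so do all finitely generated extensions of `K`. -/
theorem HasFGUnits.of_trdeg_eq (n : ℕ) {L : Type u} [Field L] (K : Type u) [Field K] [Algebra K L]
    [Algebra.EssFiniteType K L] (hn : Algebra.trdeg K L = n)
    (hK : ∀ (K' : Type u) [Field K'] [Algebra K K'] [FiniteDimensional K K'], HasFGUnits K') :
    HasFGUnits L := by
  induction n generalizing K with
  | zero =>
    have : Algebra.IsAlgebraic K L := trdeg_eq_zero_iff.mp (by simpa using hn)
    have : FiniteDimensional K L := Algebra.finite_of_essFiniteType_of_isAlgebraic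
    exact hK L
  | succ n ih =>
    obtain ⟨x, hx⟩ : ∃ x : L, Transcendental K x := by
      rw [← Algebra.transcendental_def, ← trdeg_ne_zero_iff, hn]
      exact_mod_cast n.succ_ne_zero
    have : Algebra.EssFiniteType K⟮x⟯ L := .of_comp K K⟮x⟯ L
    refine ih K⟮x⟯ ?_ fun L' _ _ _ ↦ ?_
    · rw [hx.trdeg_eq_add_one, Nat.cast_succ] at hn
      exact Cardinal.eq_of_add_eq_add_right hn Cardinal.one_lt_aleph0
    · let : Algebra K L' := ((algebraMap K⟮x⟯ L').comp (algebraMap K K⟮x⟯)).toAlgebra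
      have : IsScalarTower K K⟮x⟯ L' := .of_algebraMap_eq fun _ ↦ rfl
      have : Algebra.EssFiniteType K K⟮x⟯ := essFiniteType_iff.mpr ⟨{x}, by simp⟩
      have : Algebra.EssFiniteType K L' := .comp K K⟮x⟯ L'
      refine HasFGUnits.of_trdeg_le_one K ?_ hK
      rw [← trdeg_add_eq K K⟮x⟯ (A := L'), hx.trdeg_adjoin, trdeg_eq_zero, add_zero]

theorem HasFGUnits.of_essFiniteType (K : Type v) (L : Type u) [Field K] [Field L] [Algebra K L]
    [Algebra.EssFiniteType K L]
    (hK : ∀ (K' : Type u) [Field K'] [Algebra K K'] [FiniteDimensional K K'], HasFGUnits K') :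
    HasFGUnits L := by
  let k : IntermediateField K L := ⊥
  have : Algebra.EssFiniteType k L := .of_comp K k L
  obtain ⟨n, hn⟩ := Cardinal.lt_aleph0.mp (trdeg_lt_aleph0 k L)
  refine HasFGUnits.of_trdeg_eq n k hn fun K' _ _ _ ↦ ?_
  let : Algebra K K' := ((algebraMap k K').comp (algebraMap K k)).toAlgebra
  have : IsScalarTower K k K' := .of_algebraMap_eq fun _ ↦ rfl
  have : FiniteDimensional K K' := .trans K k K'
  exact hK K'

theorem HasFGUnits.of_essFiniteType_int (L : Type u) [Field L] [Algebra.EssFiniteType ℤ L] :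
    HasFGUnits L := by
  obtain ⟨p, hp⟩ := CharP.exists L
  obtain hp0 | rfl := CharP.char_is_prime_or_zero L p
  · have : Fact p.Prime := ⟨hp0⟩
    let := ZMod.algebra L p
    have : Algebra.EssFiniteType (ZMod p) L := .of_comp ℤ (ZMod p) L
    refine HasFGUnits.of_essFiniteType (ZMod p) L fun K' _ _ _ ↦ ?_
    have : Finite K' := Module.finite_of_finite (ZMod p)
    exact HasFGUnits.of_finite K'
  · have : CharZero L := CharP.charP_to_charZero L
    have : Algebra.EssFiniteType ℚ L := .of_comp ℤ ℚ L
    refine HasFGUnits.of_essFiniteType ℚ L fun K' _ _ _ ↦ ?_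
    have : CharZero K' := algebraRat.charZero K'
    have : NumberField K' :=
      { to_charZero := this
        to_finiteDimensional := by
          convert ‹FiniteDimensional ℚ K'›
          exact Subsingleton.elim _ _ }
    exact HasFGUnits.of_numberField K'

theorem Group.fg_units_of_isFractionRing (R L : Type*) [CommRing R] [Field L] [Algebra R L]
    [IsFractionRing R L] (hfg : (⊤ : Subalgebra ℤ R).FG) : Group.FG Rˣ := by
  have : Algebra.FiniteType ℤ R := ⟨hfg⟩
  obtain ⟨s, hs⟩ := hfg
  have : Algebra.EssFiniteType R L := .of_isLocalization _ (nonZeroDivisors R)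
  have : Algebra.EssFiniteType ℤ L := .comp ℤ R L
  let X : Set L := algebraMap R L '' s
  have hX (r : R) : algebraMap R L r ∈ Subring.closure X := by
    have hr : r ∈ Algebra.adjoin ℤ (s : Set R) := hs ▸ Algebra.mem_top
    rw [Algebra.adjoin_int] at hr
    rw [← RingHom.map_closure]
    exact ⟨r, hr, rfl⟩
  have := HasFGUnits.of_essFiniteType_int L X (s.finite_toSet.image _)
  refine Group.fg_of_injective
    (Units.map ((algebraMap R L).codRestrict (Subring.closure X) hX).toMonoidHom) ?_
  refine Units.map_injective fun a b h ↦ IsFractionRing.injective R L ?_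
  exact congrArg Subtype.val h

/-- If `R` is an integral domain that is finitely generated as a `ℤ`-algebra,
then the group of units `Rˣ` is a finitely generated (abelian) group. -/
theorem stmt_15 (R : Type*) [CommRing R] [IsDomain R]
    (hfg : (⊤ : Subalgebra ℤ R).FG) : Group.FG Rˣ := by
  exact Group.fg_units_of_isFractionRing R (FractionRing R) hfg
end
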